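/- arXiv:2011.10552 — 2 statements merged into one kernel-verified Lean document; each statement's English description precedes it below -/
import Mathlib

section
/- Let p be a prime and let c_p : ℕ → ℤ be the coefficient sequence of the infinite Borwein product G_p. Then for every integer n ≥ 0 one has c_p(n) · c_p(n+p) ≥ 0, i.e. the coefficients c_p(n) and c_p(n+p) have the same sign. -/
open Filter Topology

/-- Infinite product `∏ (1 - y q^n)`. -/
noncomputable def bwA (y q : ℝ) : ℝ := ∏' n : ℕ, (1 - y * q ^ n)

lemma bwA_summable (y q : ℝ) (h0 : 0 < q) (h1 : q < 1) : Summable (fun n : ℕ => ‖-(y * q ^ n)‖) := by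
  have : Summable (fun n : ℕ => |y| * q ^ n) := (summable_geometric_of_lt_one h0.le h1).mul_left _
  refine this.congr fun n => ?_
  simp [abs_of_pos h0]

lemma bwA_hasProd (y q : ℝ) (h0 : 0 < q) (h1 : q < 1) :
    HasProd (fun n : ℕ => 1 - y * q ^ n) (bwA y q) := by
  have := multipliable_one_add_of_summable (bwA_summable y q h0 h1)
  simpa [bwA, sub_eq_add_neg] using this.hasProd

lemma bwA_ne_zero (y q : ℝ) (h0 : 0 < q) (h1 : q < 1) (hy0 : 0 < y) (hy1 : y < 1) :
    bwA y q ≠ 0 := by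
  have := tprod_one_add_ne_zero_of_summable (f := fun n : ℕ => -(y * q ^ n)) ?_
    (bwA_summable y q h0 h1)
  · simpa [bwA, sub_eq_add_neg] using this
  · intro n
    have : q ^ n ≤ 1 := pow_le_one₀ h0.le h1.le
    have : 0 < q ^ n := pow_pos h0 n
    nlinarith

noncomputable def bwP (q : ℝ) (n : ℕ) : ℝ := ∏ i ∈ Finset.range n, (1 - q * q ^ i)

lemma bwP_succ (q : ℝ) (n : ℕ) : bwP q (n + 1) = bwP q n * (1 - q ^ (n + 1)) := by
  simp [bwP, Finset.prod_range_succ, pow_succ']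

lemma bwP_pos (q : ℝ) (h0 : 0 < q) (h1 : q < 1) (n : ℕ) : 0 < bwP q n := by
  induction n with
  | zero => simp [bwP]
  | succ n ih =>
    rw [bwP_succ]
    have : q ^ (n + 1) < 1 := pow_lt_one₀ h0.le h1 (by omega)
    exact mul_pos ih (by linarith)

lemma bwP_anti (q : ℝ) (h0 : 0 < q) (h1 : q < 1) : Antitone (bwP q) := by
  refine antitone_nat_of_succ_le fun n => ?_
  rw [bwP_succ]
  have := bwP_pos q h0 h1 n
  have : 0 < q ^ (n + 1) := pow_pos h0 _
  nlinarith

lemma bwP_tendsto (q : ℝ) (h0 : 0 < q) (h1 : q < 1) : Tendsto (bwP q) atTop (𝓝 (bwA q q)) :=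
  (bwA_hasProd q q h0 h1).tendsto_prod_nat

lemma bwP_ge (q : ℝ) (h0 : 0 < q) (h1 : q < 1) (n : ℕ) : bwA q q ≤ bwP q n :=
  (bwP_anti q h0 h1).le_of_tendsto (bwP_tendsto q h0 h1) n

lemma bwE_pos (q : ℝ) (h0 : 0 < q) (h1 : q < 1) : 0 < bwA q q := by
  have h := bwA_ne_zero q q h0 h1 h0 h1
  have : 0 ≤ bwA q q := ge_of_tendsto' (bwP_tendsto q h0 h1) fun n => (bwP_pos q h0 h1 n).le
  exact lt_of_le_of_ne this h.symm

/-- Gaussian binomial. -/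
noncomputable def bwG (q : ℝ) : ℕ → ℕ → ℝ
  | _, 0 => 1
  | 0, _ + 1 => 0
  | M + 1, j + 1 => bwG q M j + q ^ (j + 1) * bwG q M (j + 1)

lemma bwG_zero (q : ℝ) (M : ℕ) : bwG q M 0 = 1 := by cases M <;> simp [bwG]

lemma bwG_of_lt (q : ℝ) (M j : ℕ) (h : M < j) : bwG q M j = 0 := by
  induction M generalizing j with
  | zero => obtain ⟨j, rfl⟩ := Nat.exists_eq_succ_of_ne_zero h.ne'; simp [bwG]
  | succ M ih =>
    obtain ⟨j, rfl⟩ := Nat.exists_eq_succ_of_ne_zero (by omega : j ≠ 0)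
    simp [bwG, ih j (by omega), ih (j + 1) (by omega)]

lemma bwG_self (q : ℝ) (M : ℕ) : bwG q M M = 1 := by
  induction M with
  | zero => simp [bwG]
  | succ M ih => simp [bwG, ih, bwG_of_lt q M (M + 1) (by omega)]

lemma bwG_mul (q : ℝ) (j k : ℕ) : bwG q (j + k) j * (bwP q j * bwP q k) = bwP q (j + k) := by
  induction j generalizing k with
  | zero => simp [bwG_zero, bwP]
  | succ j ihj =>
    induction k with
    | zero => simp [bwG_self, bwP]
    | succ k ihk =>
      have e : j + 1 + (k + 1) = (j + 1 + k) + 1 := by ring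
      have h1 := ihj (k + 1)
      have e2 : j + (k + 1) = j + 1 + k := by ring
      rw [e2] at h1
      rw [e, bwG, bwP_succ q (j + 1 + k), bwP_succ q k, bwP_succ q j]
      rw [bwP_succ q k] at h1
      rw [bwP_succ q j] at ihk
      have : (bwG q (j + 1 + k) j + q ^ (j + 1) * bwG q (j + 1 + k) (j + 1)) *
        (bwP q j * (1 - q ^ (j + 1)) * (bwP q k * (1 - q ^ (k + 1)))) =
        (1 - q ^ (j + 1)) * (bwG q (j + 1 + k) j * (bwP q j * (bwP q k * (1 - q ^ (k + 1))))) +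
        q ^ (j + 1) * (1 - q ^ (k + 1)) *
          (bwG q (j + 1 + k) (j + 1) * (bwP q j * (1 - q ^ (j + 1)) * bwP q k)) := by ring
      rw [this, h1, ihk]
      ring

lemma bw_gauss (q : ℝ) (M : ℕ) (x : ℝ) : ∏ i ∈ Finset.range M, (1 + x * q ^ i) =
    ∑ j ∈ Finset.range (M + 1), bwG q M j * q ^ (j.choose 2) * x ^ j := by
  induction M generalizing x with
  | zero => simp [bwG]
  | succ M ih =>
    rw [Finset.prod_range_succ']
    have : ∏ k ∈ Finset.range M, (1 + x * q ^ (k + 1)) =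
        ∏ k ∈ Finset.range M, (1 + (x * q) * q ^ k) :=
      Finset.prod_congr rfl fun k _ => by ring
    rw [this, ih, Finset.sum_range_succ' _ (M + 1)]
    have h2 : ∀ j, bwG q (M + 1) (j + 1) * q ^ ((j + 1).choose 2) * x ^ (j + 1) =
        x * (bwG q M j * q ^ (j.choose 2) * (x * q) ^ j) +
        bwG q M (j + 1) * q ^ ((j + 1).choose 2) * (x * q) ^ (j + 1) := by
      intro j
      have : (j + 1).choose 2 = j + j.choose 2 := by
        rw [Nat.choose_succ_succ' j 1]; simp
      rw [bwG, this, mul_pow, mul_pow]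
      ring
    rw [Finset.sum_congr rfl (fun j _ => h2 j), Finset.sum_add_distrib, ← Finset.mul_sum]
    have h3 := Finset.sum_range_succ' (fun j => bwG q M j * q ^ (j.choose 2) * (x * q) ^ j) (M + 1)
    rw [Finset.sum_range_succ] at h3
    rw [bwG_of_lt q M (M + 1) (by omega)] at h3
    simp only [zero_mul, add_zero] at h3
    have h4 : ∑ x_1 ∈ Finset.range (M + 1),
        bwG q M (x_1 + 1) * q ^ (x_1 + 1).choose 2 * (x * q) ^ (x_1 + 1) =
      ∑ j ∈ Finset.range (M + 1), bwG q M j * q ^ (j.choose 2) * (x * q) ^ j - 1 := by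
      rw [h3]; simp [bwG_zero]
    rw [h4]
    simp [bwG_zero]
    ring

lemma bw_summable_exp (a b : ℝ) (ha : 0 < a) :
    Summable (fun k : ℤ => Real.exp (-a * (k : ℝ) ^ 2 + b * k)) := by
  have h := (summable_jacobiTheta₂_term_iff (⟨0, -b / (2 * Real.pi)⟩ : ℂ) ⟨0, a / Real.pi⟩).2
    (by simpa using div_pos ha Real.pi_pos)
  refine h.norm.congr fun k => ?_
  rw [norm_jacobiTheta₂_term]
  congr 1
  have := Real.pi_ne_zero
  field_simp
  ring

/-- bounded by `rpow`. -/
lemma bw_summable_rpow (x : ℝ) (h0 : 0 < x) (h1 : x < 1) (a b : ℝ) (ha : 0 < a) :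
    Summable (fun k : ℤ => x ^ (a * (k : ℝ) ^ 2 + b * k)) := by
  have hl := Real.log_neg h0 h1
  refine (bw_summable_exp (-Real.log x * a) (Real.log x * b) (by nlinarith)).congr fun k => ?_
  rw [Real.rpow_def_of_pos h0]
  congr 1
  ring

lemma bw_fin (q y : ℝ) (h0 : 0 < q) (hy : y ≠ 0) (N : ℕ) :
    (∏ i ∈ Finset.range N, (1 - y * q ^ i)) * (∏ i ∈ Finset.range N, (1 - q / y * q ^ i)) =
    ∑ j ∈ Finset.range (2 * N + 1), bwG q (2 * N) j *
      ((-y) ^ ((j : ℤ) - N) * q ^ ((((j : ℝ) - N) ^ 2 - ((j : ℝ) - N)) / 2)) := by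
  have hq : q ≠ 0 := h0.ne'
  have g := bw_gauss q (2 * N) (-y * (q ^ N)⁻¹)
  rw [show 2 * N = N + N by ring, Finset.prod_range_add, ← show 2 * N = N + N by ring] at g
  have e1 : ∏ i ∈ Finset.range N, (1 + -y * (q ^ N)⁻¹ * q ^ (N + i)) =
      ∏ i ∈ Finset.range N, (1 - y * q ^ i) := by
    refine Finset.prod_congr rfl fun i _ => ?_
    rw [pow_add]; field_simp; ring
  have e2 : ∏ i ∈ Finset.range N, (1 + -y * (q ^ N)⁻¹ * q ^ i) =
      (∏ i ∈ Finset.range N, (1 - q / y * q ^ i)) * ((-y) ^ N * (q ^ ((N + 1).choose 2))⁻¹) := by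
    rw [← Finset.prod_range_reflect]
    have : ∀ i ∈ Finset.range N, (1 + -y * (q ^ N)⁻¹ * q ^ (N - 1 - i)) =
        (1 - q / y * q ^ i) * (-y * (q ^ (i + 1))⁻¹) := by
      intro i hi
      have hi' := Finset.mem_range.1 hi
      have : q ^ N = q ^ (N - 1 - i) * q ^ (i + 1) := by rw [← pow_add]; congr 1; omega
      rw [this]; field_simp; ring
    rw [Finset.prod_congr rfl this, Finset.prod_mul_distrib, Finset.prod_mul_distrib,
      Finset.prod_const, Finset.card_range, Finset.prod_inv_distrib, Finset.prod_pow_eq_pow_sum]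
    congr 4
    rw [Nat.choose_two_right, ← Finset.sum_range_id_mul_two, Finset.sum_range_succ']
    simp
  rw [e1, e2] at g
  set K := (-y) ^ N * (q ^ ((N + 1).choose 2))⁻¹ with hK
  have hK0 : K ≠ 0 := by
    rw [hK]; exact mul_ne_zero (pow_ne_zero _ (neg_ne_zero.2 hy)) (inv_ne_zero (pow_ne_zero _ hq))
  apply mul_right_cancel₀ hK0
  rw [Finset.sum_mul, mul_comm (∏ i ∈ Finset.range N, (1 - y * q ^ i)), mul_assoc,
    mul_comm (∏ i ∈ Finset.range N, (1 - y * q ^ i)), ← mul_assoc, g]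
  refine Finset.sum_congr rfl fun j _ => ?_
  rw [hK, mul_pow, zpow_sub₀ (neg_ne_zero.2 hy), zpow_natCast, zpow_natCast]
  have hyN : (-y) ^ N ≠ 0 := pow_ne_zero _ (neg_ne_zero.2 hy)
  have : q ^ (j.choose 2) * ((q ^ N)⁻¹) ^ j =
      q ^ ((((j : ℝ) - N) ^ 2 - ((j : ℝ) - N)) / 2) * (q ^ ((N + 1).choose 2))⁻¹ := by
    rw [← inv_pow, ← pow_mul, inv_pow]
    rw [← Real.rpow_natCast q (j.choose 2), ← Real.rpow_natCast q (N * j),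
      ← Real.rpow_natCast q ((N + 1).choose 2), ← Real.rpow_neg h0.le,
      ← Real.rpow_neg h0.le, ← Real.rpow_add h0, ← Real.rpow_add h0]
    congr 1
    rw [Nat.cast_choose_two, Nat.cast_choose_two]
    push_cast
    ring
  calc _ = bwG q (2 * N) j * (-y) ^ j * (q ^ (j.choose 2) * ((q ^ N)⁻¹) ^ j) := by ring
    _ = _ := by rw [this]; field_simp

noncomputable def bwH (q : ℝ) (N : ℕ) (k : ℤ) : ℝ :=
  if -(N : ℤ) ≤ k then bwG q (2 * N) (k + N).toNat else 0

lemma bw_fin' (q y : ℝ) (h0 : 0 < q) (hy : y ≠ 0) (N : ℕ) :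
    ∑' k : ℤ, bwH q N k * ((-y) ^ k * q ^ (((k : ℝ) ^ 2 - k) / 2)) =
    (∏ i ∈ Finset.range N, (1 - y * q ^ i)) * (∏ i ∈ Finset.range N, (1 - q / y * q ^ i)) := by
  rw [bw_fin q y h0 hy, tsum_eq_sum (s := Finset.Icc (-(N : ℤ)) N)]
  · refine Finset.sum_nbij' (fun k => (k + N).toNat) (fun j => (j : ℤ) - N) ?_ ?_ ?_ ?_ ?_
    · intro k hk; simp at hk ⊢; omega
    · intro j hj; simp at hj ⊢; omega
    · intro k hk; simp at hk ⊢; omega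
    · intro j hj; simp
    · intro k hk
      simp only [Finset.mem_Icc] at hk
      have e : (((k + N).toNat : ℕ) : ℤ) = k + N := Int.toNat_of_nonneg (by omega)
      have e' : (((k + N).toNat : ℕ) : ℝ) = k + N := by exact_mod_cast congrArg (Int.cast (R := ℝ)) e
      rw [bwH, if_pos hk.1, e, e']
      simp
  · intro k hk
    simp only [Finset.mem_Icc, not_and, not_le] at hk
    rw [bwH]
    split_ifs with h
    · rw [bwG_of_lt _ _ _ (by have := hk h; omega)]; simp
    · simp

lemma bwG_bound (q : ℝ) (h0 : 0 < q) (h1 : q < 1) (M j : ℕ) :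
    0 ≤ bwG q M j ∧ bwG q M j ≤ 1 / (bwA q q * bwA q q) := by
  have hE := bwE_pos q h0 h1
  rcases lt_or_ge M j with h | h
  · rw [bwG_of_lt q M j h]; exact ⟨le_rfl, by positivity⟩
  · obtain ⟨k, rfl⟩ := Nat.exists_eq_add_of_le h
    have := bwG_mul q j k
    have pj := bwP_pos q h0 h1 j
    have pk := bwP_pos q h0 h1 k
    have pjk := bwP_pos q h0 h1 (j + k)
    have gj := bwP_ge q h0 h1 j
    have gk := bwP_ge q h0 h1 k
    have l1 : bwP q (j + k) ≤ 1 := by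
      simpa [bwP] using bwP_anti q h0 h1 (Nat.zero_le (j + k))
    have e : bwG q (j + k) j = bwP q (j + k) / (bwP q j * bwP q k) := by
      rw [← this]; field_simp
    rw [e]
    refine ⟨by positivity, ?_⟩
    gcongr

lemma bwH_tendsto (q : ℝ) (h0 : 0 < q) (h1 : q < 1) (k : ℤ) :
    Tendsto (fun N => bwH q N k) atTop (𝓝 (1 / bwA q q)) := by
  have hE := bwE_pos q h0 h1
  have t := bwP_tendsto q h0 h1
  have a1 : Tendsto (fun N : ℕ => ((N : ℤ) + k).toNat) atTop atTop :=
    tendsto_atTop.2 fun b => by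
      filter_upwards [eventually_ge_atTop (b + k.natAbs)] with N hN
      omega
  have a2 : Tendsto (fun N : ℕ => ((N : ℤ) - k).toNat) atTop atTop :=
    tendsto_atTop.2 fun b => by
      filter_upwards [eventually_ge_atTop (b + k.natAbs)] with N hN
      omega
  have a3 : Tendsto (fun N : ℕ => 2 * N) atTop atTop :=
    tendsto_atTop.2 fun b => by
      filter_upwards [eventually_ge_atTop b] with N hN
      omega
  have l := (t.comp a3).div ((t.comp a1).mul (t.comp a2)) (by positivity)
  have : bwA q q / (bwA q q * bwA q q) = 1 / bwA q q := by field_simp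
  rw [this] at l
  refine l.congr' ?_
  filter_upwards [eventually_ge_atTop (k.natAbs)] with N hN
  have := bwG_mul q ((N : ℤ) + k).toNat ((N : ℤ) - k).toNat
  rw [show ((N : ℤ) + k).toNat + ((N : ℤ) - k).toNat = 2 * N by omega] at this
  have pj := bwP_pos q h0 h1 ((N : ℤ) + k).toNat
  have pk := bwP_pos q h0 h1 ((N : ℤ) - k).toNat
  rw [bwH, if_pos (by omega), show k + N = N + k by ring]
  simp only [Pi.div_apply, Function.comp]
  rw [← this]
  field_simp

lemma bw_term_abs (q y : ℝ) (h0 : 0 < q) (h1 : q < 1) (hy : y ≠ 0) (k : ℤ) :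
    ‖(-y) ^ k * q ^ (((k : ℝ) ^ 2 - k) / 2)‖ =
      q ^ ((1 / 2) * (k : ℝ) ^ 2 + (Real.log |y| / Real.log q - 1 / 2) * k) := by
  have hl := Real.log_neg h0 h1
  rw [norm_mul, norm_zpow, norm_neg, Real.norm_eq_abs, Real.norm_eq_abs,
    abs_of_pos (Real.rpow_pos_of_pos h0 _), ← Real.rpow_intCast, Real.rpow_def_of_pos (abs_pos.2 hy),
    Real.rpow_def_of_pos h0, Real.rpow_def_of_pos h0, ← Real.exp_add]
  congr 1
  have := hl.ne
  field_simp
  ring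

/-- Jacobi triple product. -/
theorem bw_jtp (q y : ℝ) (h0 : 0 < q) (h1 : q < 1) (hy : y ≠ 0) :
    HasSum (fun k : ℤ => (-y) ^ k * q ^ (((k : ℝ) ^ 2 - k) / 2))
      (bwA q q * (bwA y q * bwA (q / y) q)) := by
  have hE := bwE_pos q h0 h1
  have hs : Summable (fun k : ℤ => ‖(-y) ^ k * q ^ (((k : ℝ) ^ 2 - k) / 2)‖) := by
    simp_rw [bw_term_abs q y h0 h1 hy]
    exact bw_summable_rpow q h0 h1 _ _ (by norm_num)
  have t := tendsto_tsum_of_dominated_convergence (𝓕 := atTop)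
    (f := fun (N : ℕ) (k : ℤ) => bwH q N k * ((-y) ^ k * q ^ (((k : ℝ) ^ 2 - k) / 2)))
    (hs.mul_left (1 / (bwA q q * bwA q q)))
    (fun k => (bwH_tendsto q h0 h1 k).mul_const _) ?_
  · simp_rw [bw_fin' q y h0 hy] at t
    have t2 := (bwA_hasProd y q h0 h1).tendsto_prod_nat.mul
      (bwA_hasProd (q / y) q h0 h1).tendsto_prod_nat
    have := tendsto_nhds_unique t t2
    rw [tsum_mul_left] at this
    have e : bwA q q * (bwA y q * bwA (q / y) q) =
        ∑' k : ℤ, (-y) ^ k * q ^ (((k : ℝ) ^ 2 - k) / 2) := by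
      rw [← this]; field_simp
    rw [e]
    exact hs.of_norm.hasSum
  · refine Eventually.of_forall fun N k => ?_
    rw [norm_mul]
    gcongr
    rw [Real.norm_eq_abs, bwH]
    split_ifs with h
    · have := bwG_bound q h0 h1 (2 * N) (k + N).toNat
      rw [abs_of_nonneg this.1]; exact this.2
    · simp; positivity

lemma bw_rpow_lt_one {x m : ℝ} (h0 : 0 < x) (h1 : x < 1) (hm : 0 < m) : x ^ m < 1 :=
  Real.rpow_lt_one h0.le h1 hm

lemma bw_plus (x : ℝ) (h0 : 0 < x) (h1 : x < 1) (m b : ℝ) (hm : 0 < m) :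
    HasSum (fun k : ℤ => (-1 : ℝ) ^ k * x ^ (m * ((k : ℝ) ^ 2 - k) / 2 + b * k))
      (bwA (x ^ m) (x ^ m) * (bwA (x ^ b) (x ^ m) * bwA (x ^ (m - b)) (x ^ m))) := by
  have h := bw_jtp (x ^ m) (x ^ b) (Real.rpow_pos_of_pos h0 _) (bw_rpow_lt_one h0 h1 hm)
    (Real.rpow_pos_of_pos h0 _).ne'
  rw [← Real.rpow_sub h0] at h
  refine h.congr_fun fun k => ?_
  rw [← neg_one_mul (x ^ b), mul_zpow, mul_assoc]
  congr 1
  rw [← Real.rpow_intCast (x ^ b), ← Real.rpow_mul h0.le, ← Real.rpow_mul h0.le, ← Real.rpow_add h0]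
  congr 1
  ring

lemma bw_minus (x : ℝ) (h0 : 0 < x) (h1 : x < 1) (m b : ℝ) (hm : 0 < m) :
    HasSum (fun k : ℤ => x ^ (m * ((k : ℝ) ^ 2 - k) / 2 + b * k))
      (bwA (x ^ m) (x ^ m) * (bwA (-x ^ b) (x ^ m) * bwA (-x ^ (m - b)) (x ^ m))) := by
  have h := bw_jtp (x ^ m) (-x ^ b) (Real.rpow_pos_of_pos h0 _) (bw_rpow_lt_one h0 h1 hm)
    (neg_ne_zero.2 (Real.rpow_pos_of_pos h0 _).ne')
  rw [div_neg, ← Real.rpow_sub h0] at h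
  refine h.congr_fun fun k => ?_
  rw [neg_neg, ← Real.rpow_intCast (x ^ b), ← Real.rpow_mul h0.le, ← Real.rpow_mul h0.le,
    ← Real.rpow_add h0]
  congr 1
  ring

open Classical in
lemma bw_ap (x : ℝ) (h0 : 0 < x) (h1 : x < 1) (m r : ℕ) (hm : 0 < m) :
    HasProd (fun j : ℕ => if ∃ n, j = m * n + r then 1 - x ^ j else 1)
      (bwA (x ^ r) (x ^ m)) := by
  have h := bwA_hasProd (x ^ r) (x ^ m) (pow_pos h0 _) (pow_lt_one₀ h0.le h1 hm.ne')
  have hi : Function.Injective (fun n : ℕ => m * n + r) := by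
    intro a b hab
    simp only [add_left_inj] at hab
    exact Nat.eq_of_mul_eq_mul_left hm hab
  rw [← hi.hasProd_iff]
  · refine h.congr_fun fun n => ?_
    simp only [Function.comp]
    rw [if_pos ⟨n, rfl⟩, ← pow_mul, ← pow_add, add_comm]
  · intro j hj
    rw [if_neg]
    rintro ⟨n, rfl⟩
    exact hj ⟨n, rfl⟩

lemma bw_split3 (x : ℝ) (h0 : 0 < x) (h1 : x < 1) :
    bwA (x ^ 3) (x ^ 3) * (bwA (x ^ 1) (x ^ 3) * bwA (x ^ 2) (x ^ 3)) = bwA x x := by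
  classical
  have h := (bw_ap x h0 h1 3 3 (by norm_num)).mul
    ((bw_ap x h0 h1 3 1 (by norm_num)).mul (bw_ap x h0 h1 3 2 (by norm_num)))
  have h' := bw_ap x h0 h1 1 1 (by norm_num)
  rw [pow_one] at h'
  refine HasProd.unique h (h'.congr_fun fun j => ?_)
  have c1 : (∃ n, j = 1 * n + 1) ↔ j ≠ 0 := ⟨by rintro ⟨n, rfl⟩; omega, fun h => ⟨j - 1, by omega⟩⟩
  have c2 : (∃ n, j = 3 * n + 3) ↔ (j ≠ 0 ∧ j % 3 = 0) :=
    ⟨by rintro ⟨n, rfl⟩; omega, fun h => ⟨j / 3 - 1, by omega⟩⟩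
  have c3 : (∃ n, j = 3 * n + 1) ↔ (j % 3 = 1) :=
    ⟨by rintro ⟨n, rfl⟩; omega, fun h => ⟨j / 3, by omega⟩⟩
  have c4 : (∃ n, j = 3 * n + 2) ↔ (j % 3 = 2) :=
    ⟨by rintro ⟨n, rfl⟩; omega, fun h => ⟨j / 3, by omega⟩⟩
  simp only [c1, c2, c3, c4]
  rcases (by omega : j % 3 = 0 ∨ j % 3 = 1 ∨ j % 3 = 2) with h | h | h
  · simp [h]
  · simp [h, show j ≠ 0 by omega]
  · simp [h, show j ≠ 0 by omega]

/-- Pentagonal number theorem -/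
lemma bw_penta (x : ℝ) (h0 : 0 < x) (h1 : x < 1) :
    HasSum (fun k : ℤ => (-1 : ℝ) ^ k * x ^ ((3 * (k : ℝ) ^ 2 - k) / 2)) (bwA x x) := by
  have h := bw_plus x h0 h1 3 1 (by norm_num)
  have e1 : x ^ (3 : ℝ) = x ^ 3 := by exact_mod_cast Real.rpow_natCast x 3
  have e2 : x ^ (3 - 1 : ℝ) = x ^ 2 := by
    rw [← Real.rpow_natCast x 2]; congr 1; norm_num
  have e3 : x ^ (1 : ℝ) = x ^ 1 := by simp
  rw [e1, e2, e3, bw_split3 x h0 h1] at h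
  refine h.congr_fun fun k => ?_
  congr 2
  ring

lemma bw_penta_neg (x : ℝ) (h0 : 0 < x) (h1 : x < 1) :
    HasSum (fun k : ℤ => (-1 : ℝ) ^ k * x ^ ((3 * (k : ℝ) ^ 2 + k) / 2)) (bwA x x) := by
  have h := (Equiv.neg ℤ).hasSum_iff.2 (bw_penta x h0 h1)
  refine h.congr_fun fun k => ?_
  simp only [Function.comp, Equiv.neg_apply, zpow_neg]
  congr 2
  · rw [← inv_zpow]; norm_num
  · push_cast; ring

/-- Quintuple product. -/
lemma bw_quint (x : ℝ) (h0 : 0 < x) (h1 : x < 1) (m c : ℝ) (hm : 0 < m) :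
    HasSum (fun j : ℤ => (-1 : ℝ) ^ j * (x ^ (m * (3 * (j : ℝ) ^ 2 - j) / 2 + 3 * c * j) +
        x ^ (m * (3 * (j : ℝ) ^ 2 + j) / 2 + c * (3 * j + 1))))
      (bwA (x ^ m) (x ^ m) * (bwA (-x ^ c) (x ^ m) * bwA (-x ^ (m - c)) (x ^ m)) *
        (bwA (x ^ (m + 2 * c)) (x ^ (2 * m)) * bwA (x ^ (m - 2 * c)) (x ^ (2 * m)))) := by
  have q0 : 0 < x ^ (2 * m) := Real.rpow_pos_of_pos h0 _
  have q1 : x ^ (2 * m) < 1 := bw_rpow_lt_one h0 h1 (by linarith)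
  have t1 := bw_minus x h0 h1 m c hm
  have t2 := bw_plus x h0 h1 (2 * m) (m + 2 * c) (by linarith)
  rw [show 2 * m - (m + 2 * c) = m - 2 * c by ring] at t2
  set θ := bwA (x ^ m) (x ^ m) * (bwA (-x ^ c) (x ^ m) * bwA (-x ^ (m - c)) (x ^ m))
  set ψ := bwA (x ^ (m + 2 * c)) (x ^ (2 * m)) * bwA (x ^ (m - 2 * c)) (x ^ (2 * m))
  set φ := bwA (x ^ (2 * m)) (x ^ (2 * m)) with hφ
  have hφ0 : φ ≠ 0 := (bwE_pos _ q0 q1).ne'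
  have t := t1.mul t2 (summable_mul_of_summable_norm t1.summable.norm t2.summable.norm)
  -- reindex
  let e : ℤ × ℤ ≃ ℤ × ℤ :=
    { toFun := fun z => (z.1 - 2 * z.2, z.2)
      invFun := fun z => (z.1 + 2 * z.2, z.2)
      left_inv := fun z => by simp
      right_inv := fun z => by simp }
  have te := e.hasSum_iff.2 t
  let d : (ℤ × Fin 3) × ℤ ≃ ℤ × ℤ := ((Int.divModEquiv 3).symm).prodCongr (Equiv.refl ℤ)
  have td := d.hasSum_iff.2 te
  have key : ∀ (j : ℤ) (r : Fin 3) (n : ℤ), (((fun z : ℤ × ℤ => x ^ (m * ((z.1 : ℝ) ^ 2 - z.1) / 2 + c * z.1) *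
      ((-1 : ℝ) ^ z.2 * x ^ (2 * m * ((z.2 : ℝ) ^ 2 - z.2) / 2 + (m + 2 * c) * z.2))) ∘ e) ∘ d) ((j, r), n)
      = (-1 : ℝ) ^ n * x ^ (m * ((3 * (j:ℝ) + (r : ℕ)) * ((3 * (j : ℝ) + (r : ℕ)) - 1) / 2 + 3 * (n : ℝ) ^ 2 -
        (2 * (3 * (j:ℝ) + (r : ℕ)) - 1) * n) + c * (3 * (j:ℝ) + (r : ℕ))) := by
    intro j r n
    simp only [Function.comp, e, d, Equiv.prodCongr_apply, Prod.map, Equiv.refl_apply, Equiv.coe_fn_mk,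
      Int.divModEquiv_symm_apply]
    rw [mul_left_comm, ← Real.rpow_add h0]
    congr 2
    push_cast
    ring
  have pen := bw_penta_neg _ q0 q1
  have pen' := bw_penta _ q0 q1
  rw [← hφ] at pen pen'
  have f0 : ∀ j : ℤ, HasSum (fun n : ℤ => (-1 : ℝ) ^ n * x ^ (m * ((3 * (j:ℝ) + ((0 : Fin 3) : ℕ)) *
       ((3 * (j : ℝ) + ((0 : Fin 3) : ℕ)) - 1) / 2 + 3 * (n : ℝ) ^ 2 -
        (2 * (3 * (j:ℝ) + ((0 : Fin 3) : ℕ)) - 1) * n) + c * (3 * (j:ℝ) + ((0 : Fin 3) : ℕ))))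
        (φ * ((-1) ^ j * x ^ (m * (3 * (j : ℝ) ^ 2 - j) / 2 + 3 * c * j))) := by
    intro j
    rw [← (Equiv.addRight j).hasSum_iff]
    refine (pen.mul_right _).congr_fun fun n => ?_
    simp only [Function.comp, Equiv.coe_addRight]
    rw [zpow_add₀ (by norm_num), ← Real.rpow_mul h0.le, mul_mul_mul_comm, ← Real.rpow_add h0]
    congr 2
    push_cast [Fin.val_zero]
    ring
  have f1 : ∀ j : ℤ, HasSum (fun n : ℤ => (-1 : ℝ) ^ n * x ^ (m * ((3 * (j:ℝ) + ((1 : Fin 3) : ℕ)) *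
       ((3 * (j : ℝ) + ((1 : Fin 3) : ℕ)) - 1) / 2 + 3 * (n : ℝ) ^ 2 -
        (2 * (3 * (j:ℝ) + ((1 : Fin 3) : ℕ)) - 1) * n) + c * (3 * (j:ℝ) + ((1 : Fin 3) : ℕ))))
        (φ * ((-1) ^ j * x ^ (m * (3 * (j : ℝ) ^ 2 + j) / 2 + c * (3 * j + 1)))) := by
    intro j
    rw [← (Equiv.addRight j).hasSum_iff]
    refine (pen'.mul_right _).congr_fun fun n => ?_
    simp only [Function.comp, Equiv.coe_addRight]
    rw [zpow_add₀ (by norm_num), ← Real.rpow_mul h0.le, mul_mul_mul_comm, ← Real.rpow_add h0]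
    congr 2
    push_cast [Fin.val_one]
    ring
  have f2 : ∀ j : ℤ, HasSum (fun n : ℤ => (-1 : ℝ) ^ n * x ^ (m * ((3 * (j:ℝ) + ((2 : Fin 3) : ℕ)) *
       ((3 * (j : ℝ) + ((2 : Fin 3) : ℕ)) - 1) / 2 + 3 * (n : ℝ) ^ 2 -
        (2 * (3 * (j:ℝ) + ((2 : Fin 3) : ℕ)) - 1) * n) + c * (3 * (j:ℝ) + ((2 : Fin 3) : ℕ)))) 0 := by
    intro j
    have s := ((td.summable).prod_factor (j, 2)).hasSum
    simp only [key] at s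
    have s' := (Equiv.subLeft (2 * j + 1)).hasSum_iff.2 s
    have s'' := s'.congr_fun (g := fun n : ℤ => -((-1 : ℝ) ^ n * x ^ (m * ((3 * (j:ℝ) + ((2 : Fin 3) : ℕ)) *
       ((3 * (j : ℝ) + ((2 : Fin 3) : ℕ)) - 1) / 2 + 3 * (n : ℝ) ^ 2 -
        (2 * (3 * (j:ℝ) + ((2 : Fin 3) : ℕ)) - 1) * n) + c * (3 * (j:ℝ) + ((2 : Fin 3) : ℕ))))) ?_
    · have := s''.unique s.neg
      have e0 := self_eq_neg.1 this
      rw [e0] at s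
      exact s
    · intro n
      simp only [Function.comp, Equiv.subLeft_apply]
      rw [zpow_sub₀ (by norm_num), zpow_add₀ (by norm_num), zpow_mul]
      rw [← neg_mul]
      congr 1
      · simp [div_eq_mul_inv, ← inv_zpow]
      · congr 1
        push_cast [Fin.val_two]
        ring
  let g : ℤ × Fin 3 → ℝ := fun z => if z.2 = 0 then
      φ * ((-1) ^ z.1 * x ^ (m * (3 * (z.1 : ℝ) ^ 2 - z.1) / 2 + 3 * c * z.1)) else if z.2 = 1 then
      φ * ((-1) ^ z.1 * x ^ (m * (3 * (z.1 : ℝ) ^ 2 + z.1) / 2 + c * (3 * z.1 + 1))) else 0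
  have tg : HasSum g (θ * (φ * ψ)) := by
    refine td.prod_fiberwise ?_
    rintro ⟨j, r⟩
    simp only [key]
    fin_cases r
    · exact f0 j
    · exact f1 j
    · exact f2 j
  have th := tg.prod_fiberwise (fun j => hasSum_fintype (fun r => g (j, r)))
  rw [← hasSum_mul_left_iff hφ0, show φ * (θ * ψ) = θ * (φ * ψ) by ring]
  refine th.congr_fun fun j => ?_
  simp [Fin.sum_univ_three, g]
  ring

/-- `f` is on `(0,1)` the sum of a power series with nonnegative coefficients. -/
def bwNN (f : ℝ → ℝ) : Prop :=
  ∃ a : ℕ → ℝ, (∀ n, 0 ≤ a n) ∧ ∀ x : ℝ, 0 < x → x < 1 → HasSum (fun n => a n * x ^ n) (f x)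

/-- Same with constant coefficient at least one. -/
def bwNO (f : ℝ → ℝ) : Prop :=
  ∃ a : ℕ → ℝ, (∀ n, 0 ≤ a n) ∧ 1 ≤ a 0 ∧
    ∀ x : ℝ, 0 < x → x < 1 → HasSum (fun n => a n * x ^ n) (f x)

lemma bw_cauchy (a b : ℕ → ℝ) (x A B : ℝ)
    (h1 : HasSum (fun n => a n * x ^ n) A) (h2 : HasSum (fun n => b n * x ^ n) B) :
    HasSum (fun n => (∑ z ∈ Finset.HasAntidiagonal.antidiagonal n, a z.1 * b z.2) * x ^ n) (A * B) := by
  have s1 := h1.summable.norm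
  have s2 := h2.summable.norm
  have e := tsum_mul_tsum_eq_tsum_sum_antidiagonal_of_summable_norm s1 s2
  have s := (summable_norm_sum_mul_antidiagonal_of_summable_norm s1 s2).of_norm
  rw [h1.tsum_eq, h2.tsum_eq] at e
  rw [e]
  refine s.hasSum.congr_fun fun n => ?_
  rw [Finset.sum_mul]
  refine Finset.sum_congr rfl fun z hz => ?_
  rw [← Finset.HasAntidiagonal.mem_antidiagonal.1 hz, pow_add]
  ring

lemma bwNN.mul {f g : ℝ → ℝ} (hf : bwNN f) (hg : bwNN g) : bwNN (fun x => f x * g x) := by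
  obtain ⟨a, ha, hfa⟩ := hf
  obtain ⟨b, hb, hgb⟩ := hg
  exact ⟨fun n => ∑ z ∈ Finset.HasAntidiagonal.antidiagonal n, a z.1 * b z.2,
    fun n => Finset.sum_nonneg fun z _ => mul_nonneg (ha _) (hb _),
    fun x h0 h1 => bw_cauchy a b x _ _ (hfa x h0 h1) (hgb x h0 h1)⟩

lemma bwNN.congr {f g : ℝ → ℝ} (hf : bwNN f) (h : ∀ x, 0 < x → x < 1 → g x = f x) : bwNN g := by
  obtain ⟨a, ha, hfa⟩ := hf
  exact ⟨a, ha, fun x h0 h1 => by rw [h x h0 h1]; exact hfa x h0 h1⟩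

noncomputable def bwB (a : ℕ → ℕ → ℝ) : ℕ → ℕ → ℝ
  | 0, n => if n = 0 then 1 else 0
  | N + 1, n => ∑ z ∈ Finset.HasAntidiagonal.antidiagonal n, bwB a N z.1 * a N z.2

lemma bw_prod (g : ℕ → ℝ → ℝ) (P : ℝ → ℝ) (hg : ∀ i, bwNO (g i))
    (hP : ∀ x : ℝ, 0 < x → x < 1 → HasProd (fun i => g i x) (P x)) : bwNN P := by
  choose a ha ha0 hs using hg
  have b0 : ∀ N n, 0 ≤ bwB a N n := by
    intro N
    induction N with
    | zero => intro n; simp only [bwB]; split_ifs <;> norm_num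
    | succ N ih =>
      intro n
      exact Finset.sum_nonneg fun z _ => mul_nonneg (ih _) (ha _ _)
  have bm : ∀ n, Monotone (fun N => bwB a N n) := by
    intro n
    refine monotone_nat_of_le_succ fun N => ?_
    have : bwB a N n * a N 0 ≤ bwB a (N + 1) n := by
      rw [bwB]
      exact Finset.single_le_sum (f := fun z : ℕ × ℕ => bwB a N z.1 * a N z.2)
        (fun z _ => mul_nonneg (b0 _ _) (ha _ _)) (a := (n, 0)) (by simp)
    have h1 := ha0 N
    have h2 := b0 N n
    nlinarith
  have bs : ∀ N x, 0 < x → x < 1 →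
      HasSum (fun n => bwB a N n * x ^ n) (∏ i ∈ Finset.range N, g i x) := by
    intro N x h0 h1
    induction N with
    | zero =>
      have := hasSum_ite_eq (0 : ℕ) (1 : ℝ)
      simp only [Finset.range_zero, Finset.prod_empty]
      refine this.congr_fun fun n => ?_
      simp only [bwB]
      split_ifs with h
      · simp [h]
      · simp
    | succ N ih =>
      rw [Finset.prod_range_succ]
      exact bw_cauchy _ _ x _ _ ih (hs N x h0 h1)
  have bb : ∀ n, BddAbove (Set.range fun N => bwB a N n) := by
    intro n
    have t := (hP (1 / 2) (by norm_num) (by norm_num)).tendsto_prod_nat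
    obtain ⟨C, hC⟩ := t.bddAbove_range
    refine ⟨C / (1 / 2) ^ n, ?_⟩
    rintro _ ⟨N, rfl⟩
    rw [le_div_iff₀ (by positivity)]
    refine le_trans ?_ (hC ⟨N, rfl⟩)
    exact le_hasSum (bs N (1 / 2) (by norm_num) (by norm_num)) n
      fun j _ => mul_nonneg (b0 _ _) (by positivity)
  have bt : ∀ n, Tendsto (fun N => bwB a N n) atTop (𝓝 (⨆ N, bwB a N n)) :=
    fun n => tendsto_atTop_ciSup (bm n) (bb n)
  have bl : ∀ N n, bwB a N n ≤ ⨆ N, bwB a N n := fun N n => le_ciSup (bb n) N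
  refine ⟨fun n => ⨆ N, bwB a N n, fun n => (b0 0 n).trans (bl 0 n), fun x h0 h1 => ?_⟩
  have nn : ∀ n, 0 ≤ (⨆ N, bwB a N n) * x ^ n :=
    fun n => mul_nonneg ((b0 0 n).trans (bl 0 n)) (by positivity)
  have t := (hP x h0 h1).tendsto_prod_nat
  have fin : ∀ s : Finset ℕ, ∑ n ∈ s, (⨆ N, bwB a N n) * x ^ n ≤ P x := by
    intro s
    refine le_of_tendsto_of_tendsto' (tendsto_finsetSum s fun n _ => (bt n).mul_const (x ^ n)) t ?_
    intro N
    exact sum_le_hasSum s (fun n _ => mul_nonneg (b0 _ _) (by positivity)) (bs N x h0 h1)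
  have su : Summable (fun n => (⨆ N, bwB a N n) * x ^ n) := summable_of_sum_le nn fin
  have le1 : ∑' n, (⨆ N, bwB a N n) * x ^ n ≤ P x := su.tsum_le_of_sum_le fin
  have le2 : P x ≤ ∑' n, (⨆ N, bwB a N n) * x ^ n := by
    refine le_of_tendsto' t fun N => ?_
    rw [← (bs N x h0 h1).tsum_eq]
    refine (bs N x h0 h1).summable.tsum_le_tsum (fun n => ?_) su
    exact mul_le_mul_of_nonneg_right (bl N n) (by positivity)
  rw [le_antisymm le2 le1]
  exact su.hasSum

lemma bwNO_one : bwNO (fun _ => 1) := by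
  refine ⟨fun n => if n = 0 then 1 else 0, fun n => by dsimp only; split_ifs <;> norm_num, by simp, ?_⟩
  intro x _ _
  refine (hasSum_ite_eq (0 : ℕ) (1 : ℝ)).congr_fun fun n => ?_
  split_ifs with h <;> simp [h]

lemma bwNO_add (j : ℕ) (hj : 0 < j) : bwNO (fun x => 1 + x ^ j) := by
  refine ⟨fun n => (if n = 0 then 1 else 0) + if n = j then 1 else 0,
    fun n => by dsimp only; split_ifs <;> norm_num, by simp [hj.ne], ?_⟩
  intro x _ _
  refine ((hasSum_ite_eq (0 : ℕ) (1 : ℝ)).add (hasSum_ite_eq j (x ^ j))).congr_fun fun n => ?_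
  rw [add_mul]
  congr 1 <;> split_ifs with h <;> simp [h]

lemma bwNO_geom (j : ℕ) (hj : 0 < j) : bwNO (fun x => (1 - x ^ j)⁻¹) := by
  refine ⟨fun n => if j ∣ n then 1 else 0, fun n => by dsimp only; split_ifs <;> norm_num, by simp, ?_⟩
  intro x h0 h1
  have hi : Function.Injective (fun n : ℕ => j * n) := fun a b hab => Nat.eq_of_mul_eq_mul_left hj hab
  rw [← hi.hasSum_iff]
  · refine (hasSum_geometric_of_lt_one (r := x ^ j) (by positivity)
      (pow_lt_one₀ h0.le h1 hj.ne')).congr_fun fun n => ?_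
    simp [pow_mul]
  · intro n hn
    dsimp only
    rw [if_neg, zero_mul]
    rintro ⟨k, rfl⟩
    exact hn ⟨k, rfl⟩

lemma bwNN_plus (r m : ℕ) (hr : 0 < r) (hm : 0 < m) : bwNN (fun x => bwA (-x ^ r) (x ^ m)) := by
  refine bw_prod (fun n x => 1 + x ^ (r + m * n)) _ (fun n => bwNO_add _ (by omega)) ?_
  intro x h0 h1
  refine (bwA_hasProd (-x ^ r) (x ^ m) (pow_pos h0 _) (pow_lt_one₀ h0.le h1 hm.ne')).congr_fun
    fun n => ?_
  rw [pow_add, pow_mul]; ring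

open Classical in
/-- `F` is the product of `1 - x^j` over `j ∈ S`. -/
def bwHP (S : ℕ → Prop) (F : ℝ → ℝ) : Prop :=
  ∀ x : ℝ, 0 < x → x < 1 → HasProd (fun j : ℕ => if S j then 1 - x ^ j else 1) (F x)

lemma bwHP_ap (m r : ℕ) (hm : 0 < m) :
    bwHP (fun j => ∃ n, j = m * n + r) (fun x => bwA (x ^ r) (x ^ m)) :=
  fun x h0 h1 => bw_ap x h0 h1 m r hm

lemma bwHP_union (S T : ℕ → Prop) (F G : ℝ → ℝ) (hS : bwHP S F) (hT : bwHP T G)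
    (h : ∀ j, S j → T j → False) : bwHP (fun j => S j ∨ T j) (fun x => F x * G x) := by
  intro x h0 h1
  refine ((hS x h0 h1).mul (hT x h0 h1)).congr_fun fun j => ?_
  have := h j
  by_cases h1 : S j <;> by_cases h2 : T j <;> simp_all

lemma bwNN_quot (S : ℕ → Prop) (F : ℝ → ℝ) (hS : bwHP S F) (h : ¬ S 0) :
    bwNN (fun x => F x / bwA x x) := by
  classical
  have hE := bwHP_ap 1 1 one_pos
  refine bw_prod (fun j x => if S j ∨ j = 0 then 1 else (1 - x ^ j)⁻¹) _ ?_ ?_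
  · intro j
    by_cases hj : S j ∨ j = 0
    · simp only [hj, if_true]; exact bwNO_one
    · simp only [hj, if_false]; exact bwNO_geom j (by omega)
  · intro x h0 h1
    have h2 := hE x h0 h1
    simp only [pow_one] at h2
    have := (hS x h0 h1).mul (h2.inv₀ (bwE_pos x h0 h1).ne')
    rw [div_eq_mul_inv]
    refine this.congr_fun fun j => ?_
    by_cases hj : j = 0
    · subst hj; simp [h]
    · have c1 : ∃ n, j = 1 * n + 1 := ⟨j - 1, by omega⟩
      have : (1 - x ^ j) ≠ 0 := by
        have := pow_lt_one₀ h0.le h1 hj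
        linarith
      rw [if_pos c1]
      by_cases hs : S j <;> simp [hj, hs, this]

/-- unique coefficients -/
lemma bw_unique (d : ℕ → ℝ) (h : ∀ x : ℝ, 0 < x → x < 1 → HasSum (fun n => d n * x ^ n) 0) :
    ∀ n, d n = 0 := by
  intro n
  induction n using Nat.strong_induction_on with
  | _ n ih =>
  have hs : ∀ x : ℝ, 0 < x → x < 1 → HasSum (fun k => d (k + n) * x ^ k) 0 := by
    intro x h0 h1
    have h2 := (hasSum_nat_add_iff' n).2 (h x h0 h1)
    rw [Finset.sum_eq_zero (fun i hi => by rw [ih i (Finset.mem_range.1 hi), zero_mul]), sub_zero] at h2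
    rw [← hasSum_mul_right_iff (pow_pos h0 n).ne', zero_mul]
    refine h2.congr_fun fun k => ?_
    ring
  have hsum := (hs (1 / 2) (by norm_num) (by norm_num)).summable.norm
  have hsum' := (summable_nat_add_iff 1).2 hsum
  set C := ∑' k, ‖d (k + 1 + n) * (1 / 2 : ℝ) ^ (k + 1)‖ with hC
  have bd : ∀ x : ℝ, 0 < x → x < 1 / 2 → |d n| ≤ 2 * x * C := by
    intro x h0 h1
    have h2 := (hasSum_nat_add_iff' 1).2 (hs x h0 (by linarith))
    simp only [Finset.sum_range_one, zero_add, pow_zero, mul_one, zero_sub] at h2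
    have h3 : ‖∑' k, d (k + 1 + n) * x ^ (k + 1)‖ ≤ 2 * x * C := by
      rw [hC, ← tsum_mul_left]
      refine tsum_of_norm_bounded (hsum'.mul_left (2 * x)).hasSum fun k => ?_
      rw [norm_mul, norm_mul, norm_pow, norm_pow]
      have e1 : ‖x‖ = x := by rw [Real.norm_eq_abs, abs_of_pos h0]
      have e2 : ‖(1 / 2 : ℝ)‖ = 1 / 2 := by norm_num
      rw [e1, e2]
      have e3 : x ^ k ≤ (1 / 2) ^ k := pow_le_pow_left₀ h0.le h1.le k
      calc ‖d (k + 1 + n)‖ * x ^ (k + 1) = ‖d (k + 1 + n)‖ * x * x ^ k := by ring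
        _ ≤ ‖d (k + 1 + n)‖ * x * (1 / 2) ^ k := by gcongr
        _ = _ := by ring
    rw [h2.tsum_eq] at h3
    simpa using h3
  have t : Tendsto (fun x : ℝ => 2 * x * C) (𝓝[>] 0) (𝓝 0) := by
    have : Continuous (fun x : ℝ => 2 * x * C) := by fun_prop
    have := this.tendsto 0
    simp only [mul_zero, zero_mul] at this
    exact this.mono_left nhdsWithin_le_nhds
  have : |d n| ≤ 0 := by
    refine ge_of_tendsto t ?_
    filter_upwards [Ioo_mem_nhdsGT (show (0 : ℝ) < 1 / 2 by norm_num)] with x hx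
    exact bd x hx.1 hx.2
  exact abs_nonpos_iff.1 this

lemma bw_dil (p e : ℕ) (hp : 0 < p) (H : ℝ → ℝ) (hH : bwNN H) :
    ∃ b : ℕ → ℝ, (∀ n, 0 ≤ b n) ∧ (∀ n, b n ≠ 0 → n ≡ e [MOD p]) ∧
      ∀ x : ℝ, 0 < x → x < 1 → HasSum (fun n => b n * x ^ n) (x ^ e * H (x ^ p)) := by
  classical
  obtain ⟨a, ha, hs⟩ := hH
  refine ⟨fun n => if ∃ k, n = e + p * k then a ((n - e) / p) else 0, ?_, ?_, ?_⟩
  · intro n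
    dsimp only
    split_ifs
    · exact ha _
    · exact le_rfl
  · intro n hn
    dsimp only at hn
    split_ifs at hn with h
    · obtain ⟨k, rfl⟩ := h
      simp [Nat.ModEq]
    · exact absurd rfl hn
  · intro x h0 h1
    have hi : Function.Injective (fun k : ℕ => e + p * k) := by
      intro a b hab
      simp only [add_right_inj] at hab
      exact Nat.eq_of_mul_eq_mul_left hp hab
    rw [← hi.hasSum_iff]
    · refine ((hs (x ^ p) (pow_pos h0 _) (pow_lt_one₀ h0.le h1 hp.ne')).mul_left (x ^ e)).congr_fun
        fun k => ?_
      simp only [Function.comp]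
      rw [if_pos ⟨k, rfl⟩, Nat.add_sub_cancel_left, Nat.mul_div_cancel_left _ hp, pow_add, pow_mul]
      ring
    · intro n hn
      dsimp only
      rw [if_neg, zero_mul]
      rintro ⟨k, rfl⟩
      exact hn ⟨k, rfl⟩

lemma bw_comb (p : ℕ) (hp : 0 < p) (c : ℕ → ℤ) (I : Finset ℕ) (s : ℕ → ℝ) (e : ℕ → ℕ)
    (H : ℕ → ℝ → ℝ) (hH : ∀ i ∈ I, bwNN (H i))
    (he : ∀ i ∈ I, ∀ j ∈ I, e i ≡ e j [MOD p] → i = j)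
    (hc : ∀ x : ℝ, 0 < x → x < 1 →
      HasSum (fun n => (c n : ℝ) * x ^ n) (∑ i ∈ I, s i * (x ^ e i * H i (x ^ p)))) :
    ∀ n, 0 ≤ c n * c (n + p) := by
  have hb : ∀ i, ∃ b : ℕ → ℝ, i ∈ I → ((∀ n, 0 ≤ b n) ∧ (∀ n, b n ≠ 0 → n ≡ e i [MOD p]) ∧
      ∀ x : ℝ, 0 < x → x < 1 → HasSum (fun n => b n * x ^ n) (x ^ e i * H i (x ^ p))) := by
    intro i
    by_cases hi : i ∈ I
    · obtain ⟨b, h⟩ := bw_dil p (e i) hp (H i) (hH i hi)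
      exact ⟨b, fun _ => h⟩
    · exact ⟨0, fun h => absurd h hi⟩
  choose b hb using hb
  have cn : ∀ n, (c n : ℝ) = ∑ i ∈ I, s i * b i n := by
    intro n
    have := bw_unique (fun n => (c n : ℝ) - ∑ i ∈ I, s i * b i n) ?_ n
    · linarith
    · intro x h0 h1
      have h2 := hasSum_sum (s := I) (f := fun i n => s i * (b i n * x ^ n))
        (a := fun i => s i * (x ^ e i * H i (x ^ p)))
        (fun i hi => ((hb i hi).2.2 x h0 h1).mul_left (s i))
      have h3 := (hc x h0 h1).sub h2
      rw [sub_self] at h3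
      refine h3.congr_fun fun n => ?_
      rw [sub_mul, Finset.sum_mul]
      congr 1
      exact Finset.sum_congr rfl fun i _ => by ring
  intro n
  have : (0 : ℝ) ≤ (c n : ℝ) * c (n + p) := by
    rw [cn, cn, Finset.sum_mul_sum]
    refine Finset.sum_nonneg fun i hi => Finset.sum_nonneg fun j hj => ?_
    by_cases h : i = j
    · subst h
      have h1 := (hb i hi).1 n
      have h2 := (hb i hi).1 (n + p)
      have : s i * b i n * (s i * b i (n + p)) = s i ^ 2 * (b i n * b i (n + p)) := by ring
      rw [this]
      positivity
    · by_cases h1 : b i n = 0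
      · simp [h1]
      by_cases h2 : b j (n + p) = 0
      · simp [h2]
      exfalso
      apply h
      refine he i hi j hj ?_
      have m1 := (hb i hi).2.1 n h1
      have m2 := (hb j hj).2.1 (n + p) h2
      have m3 : n + p ≡ n [MOD p] := by simp [Nat.ModEq]
      exact m1.symm.trans (m3.symm.trans m2)
  exact_mod_cast this

lemma bw_val (p : ℕ) (hp : 0 < p) (x : ℝ) (h0 : 0 < x) (h1 : x < 1) :
    HasProd (fun n : ℕ => if p ∣ (n + 1) then 1 else (1 - x ^ (n + 1)))
      (bwA x x / bwA (x ^ p) (x ^ p)) := by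
  classical
  have a1 := bw_ap x h0 h1 1 1 one_pos
  have a2 := bw_ap x h0 h1 p p hp
  have hE := bwE_pos (x ^ p) (pow_pos h0 _) (pow_lt_one₀ h0.le h1 hp.ne')
  have h := a1.mul (a2.inv₀ hE.ne')
  rw [pow_one, ← div_eq_mul_inv] at h
  have hi : Function.Injective (fun n : ℕ => n + 1) := fun a b h => by simpa using h
  rw [← hi.hasProd_iff] at h
  · refine h.congr_fun fun n => ?_
    simp only [Function.comp]
    have c1 : ∃ k, n + 1 = 1 * k + 1 := ⟨n, by ring⟩
    have c2 : (∃ k, n + 1 = p * k + p) ↔ p ∣ (n + 1) := by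
      constructor
      · rintro ⟨k, hk⟩; exact ⟨k + 1, by rw [hk]; ring⟩
      · rintro ⟨k, hk⟩
        obtain ⟨k, rfl⟩ := Nat.exists_eq_succ_of_ne_zero (n := k) (by rintro rfl; simp at hk)
        exact ⟨k, by rw [hk, Nat.succ_eq_add_one]; ring⟩
    have : (1 - x ^ (n + 1)) ≠ 0 := by
      have := pow_lt_one₀ h0.le h1 (Nat.succ_ne_zero n)
      simp only [Nat.succ_eq_add_one] at this
      linarith
    rw [if_pos c1]
    simp only [c2]
    split_ifs
    · rw [mul_inv_cancel₀ this]
    · simp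
  · intro j hj
    have : j = 0 := by
      by_contra h
      exact hj ⟨j - 1, by simp; omega⟩
    subst this
    rw [if_neg (by rintro ⟨k, hk⟩; omega), if_neg (by rintro ⟨k, hk⟩; omega)]
    simp

lemma bw_real (p : ℕ) (c : ℕ → ℤ)
    (hc : ∀ q : ℂ, ‖q‖ < 1 →
      HasSum (fun n : ℕ => (c n : ℂ) * q ^ n)
        (∏' n : ℕ, if p ∣ (n + 1) then 1 else (1 - q ^ (n + 1)))) (y V : ℝ) (hy : |y| < 1)
    (hV : HasProd (fun n : ℕ => if p ∣ (n + 1) then 1 else (1 - y ^ (n + 1))) V) :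
    HasSum (fun n => (c n : ℝ) * y ^ n) V := by
  have h := hc (y : ℂ) (by simpa using hy)
  have hV' := hV.map Complex.ofRealHom Complex.continuous_ofReal
  have : HasProd (fun n : ℕ => if p ∣ (n + 1) then 1 else (1 - (y : ℂ) ^ (n + 1))) (V : ℂ) := by
    refine hV'.congr_fun fun n => ?_
    simp only [Function.comp]
    split_ifs <;> simp
  rw [this.tprod_eq] at h
  rw [← Complex.hasSum_ofReal]
  refine h.congr_fun fun n => ?_
  simp

lemma bw_two (c : ℕ → ℤ)
    (hc : ∀ q : ℂ, ‖q‖ < 1 →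
      HasSum (fun n : ℕ => (c n : ℂ) * q ^ n)
        (∏' n : ℕ, if 2 ∣ (n + 1) then 1 else (1 - q ^ (n + 1)))) :
    ∀ n, 0 ≤ c n * c (n + 2) := by
  obtain ⟨a, ha, hs⟩ := bwNN_plus 1 2 one_pos two_pos
  have e : ∀ n, (c n : ℝ) * (-1) ^ n = a n := by
    intro n
    have := bw_unique (fun n => (c n : ℝ) * (-1) ^ n - a n) ?_ n
    · linarith
    · intro x h0 h1
      have h2 := bw_real 2 c hc (-x) (bwA (-x ^ 1) (x ^ 2)) (by rw [abs_neg, abs_of_pos h0]; exact h1) ?_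
      · have := h2.sub (hs x h0 h1)
        rw [sub_self] at this
        refine this.congr_fun fun n => ?_
        rw [neg_pow x]
        ring
      · have hi : Function.Injective (fun n : ℕ => 2 * n) := fun a b h => by simpa using h
        rw [← hi.hasProd_iff]
        · refine (bwA_hasProd (-x ^ 1) (x ^ 2) (pow_pos h0 _)
            (pow_lt_one₀ h0.le h1 two_ne_zero)).congr_fun fun n => ?_
          simp only [Function.comp]
          rw [if_neg (by omega), ← pow_mul, pow_succ, Even.neg_pow ⟨n, by ring⟩]
          ring
        · intro n hn
          rw [if_pos]
          by_contra h
          exact hn ⟨n / 2, by simp only; omega⟩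
  intro n
  have : (0 : ℝ) ≤ (c n : ℝ) * c (n + 2) := by
    have h1 := e n
    have h2 := e (n + 2)
    have h3 : (c n : ℝ) * c (n + 2) = a n * a (n + 2) := by
      rw [← h1, ← h2]
      have : ((-1 : ℝ) ^ n) * (-1) ^ n = 1 := by rw [← mul_pow]; simp
      rw [pow_add]
      linear_combination (-(c n : ℝ) * c (n + 2)) * this
    rw [h3]
    exact mul_nonneg (ha _) (ha _)
  exact_mod_cast this

lemma bw_classes (p : ℕ) (hp : 0 < p) (f : ℤ → ℝ) (S : ℝ) (hf : HasSum f S) :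
    (∀ r : ℤ, Summable (fun j : ℤ => f (r + p * j))) ∧
    S = ∑ r ∈ Finset.range p, ∑' j : ℤ, f ((r : ℤ) + p * j) := by
  have hs : ∀ r : ℤ, Summable (fun j : ℤ => f (r + p * j)) := by
    intro r
    have hi : Function.Injective (fun j : ℤ => r + p * j) := by
      intro a b hab
      simp only [add_right_inj] at hab
      exact mul_left_cancel₀ (by exact_mod_cast hp.ne') hab
    exact hf.summable.comp_injective hi
  refine ⟨hs, ?_⟩
  have : NeZero p := ⟨hp.ne'⟩
  have h1 := (Int.divModEquiv p).symm.hasSum_iff.2 hf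
  have h2 := (Equiv.prodComm (Fin p) ℤ).hasSum_iff.2 h1
  have h3 := h2.prod_fiberwise (g := fun r : Fin p => ∑' j : ℤ, f (((r : ℕ) : ℤ) + p * j)) ?_
  · rw [← h3.unique (hasSum_fintype _) |>.symm]
    exact (Finset.sum_range (fun r : ℕ => ∑' j : ℤ, f ((r : ℤ) + p * j))).symm
  · intro r
    refine (hs (r : ℕ)).hasSum.congr_fun fun j => ?_
    simp [Function.comp, Int.divModEquiv_symm_apply, add_comm, mul_comm]

lemma bw_sign (p : ℕ) (hp : Odd p) (r j : ℤ) :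
    (-1 : ℝ) ^ (r + p * j) = (-1) ^ r * (-1) ^ j := by
  rw [zpow_add₀ (by norm_num), zpow_mul, zpow_natCast, hp.neg_one_pow]

lemma bw_three (c : ℕ → ℤ)
    (hc : ∀ q : ℂ, ‖q‖ < 1 →
      HasSum (fun n : ℕ => (c n : ℂ) * q ^ n)
        (∏' n : ℕ, if 3 ∣ (n + 1) then 1 else (1 - q ^ (n + 1)))) :
    ∀ n, 0 ≤ c n * c (n + 3) := by
  refine bw_comb 3 (by norm_num) c (Finset.range 3) (fun r => (-1) ^ ((r : ℤ) - 1))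
    (fun r => if r = 0 then 2 else if r = 1 then 0 else 1)
    (fun r x => (bwA (x ^ 9) (x ^ 9) * (bwA (x ^ (3 * r + 1)) (x ^ 9) * bwA (x ^ (8 - 3 * r)) (x ^ 9)))
      / bwA x x) ?_ ?_ ?_
  · intro r hr
    have hr' := Finset.mem_range.1 hr
    refine bwNN_quot _ _ (bwHP_union _ _ _ _ (bwHP_ap 9 9 (by norm_num))
      (bwHP_union _ _ _ _ (bwHP_ap 9 (3 * r + 1) (by norm_num)) (bwHP_ap 9 (8 - 3 * r) (by norm_num)) ?_) ?_) ?_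
    · rintro j ⟨n, hn⟩ ⟨k, hk⟩; omega
    · rintro j ⟨n, hn⟩ (⟨k, hk⟩ | ⟨k, hk⟩) <;> omega
    · rintro (⟨n, hn⟩ | ⟨k, hk⟩ | ⟨k, hk⟩) <;> omega
  · intro i hi j hj h
    have hi' := Finset.mem_range.1 hi
    have hj' := Finset.mem_range.1 hj
    interval_cases i <;> interval_cases j <;> simp_all [Nat.ModEq]
  · intro x h0 h1
    have X0 : 0 < x ^ 3 := pow_pos h0 _
    have X1 : x ^ 3 < 1 := pow_lt_one₀ h0.le h1 (by norm_num)
    have hv := bw_real 3 c hc x _ (by rw [abs_of_pos h0]; exact h1) (bw_val 3 (by norm_num) x h0 h1)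
    convert hv using 1
    have hf := (Equiv.subRight (1 : ℤ)).hasSum_iff.2 (bw_penta x h0 h1)
    have hcl := (bw_classes 3 (by norm_num) _ _ hf).2
    rw [hcl, Finset.sum_div]
    refine Finset.sum_congr rfl fun r hr => ?_
    have hr' := Finset.mem_range.1 hr
    rw [← mul_div_assoc, ← mul_div_assoc]
    congr 1
    have t := bw_plus (x ^ 3) X0 X1 9 (3 * r + 1) (by norm_num)
    have n1 : (x ^ 3) ^ (9 : ℝ) = (x ^ 3) ^ 9 := Real.rpow_ofNat _ 9
    have n2 : (x ^ 3) ^ (3 * (r : ℝ) + 1) = (x ^ 3) ^ (3 * r + 1) := by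
      rw [← Real.rpow_natCast (x ^ 3) (3 * r + 1)]; congr 1; push_cast; ring
    have n3 : (x ^ 3) ^ (9 - (3 * (r : ℝ) + 1)) = (x ^ 3) ^ (8 - 3 * r) := by
      rw [← Real.rpow_natCast (x ^ 3) (8 - 3 * r), Nat.cast_sub (by omega)]; congr 1; push_cast; ring
    rw [n1, n2, n3] at t
    symm
    rw [← mul_assoc]
    refine HasSum.tsum_eq ((t.mul_left _).congr_fun fun j => ?_)
    simp only [Function.comp, Equiv.subRight_apply]
    have hs := bw_sign 3 (by decide) (r - 1) j
    rw [show (r : ℤ) + ((3 : ℕ) : ℤ) * j - 1 = r - 1 + (3 : ℕ) * j by ring, hs]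
    have : x ^ ((3 * (((r : ℤ) - 1 + ((3 : ℕ) : ℤ) * j : ℤ) : ℝ) ^ 2 - (((r : ℤ) - 1 + ((3 : ℕ) : ℤ) * j : ℤ) : ℝ)) / 2)
       = x ^ (if r = 0 then 2 else if r = 1 then 0 else 1) *
        (x ^ 3) ^ (9 * ((j : ℝ) ^ 2 - j) / 2 + (3 * r + 1) * j) := by
      rw [← Real.rpow_natCast x 3, ← Real.rpow_mul h0.le, ← Real.rpow_natCast x (if r = 0 then _ else _),
        ← Real.rpow_add h0]
      congr 1
      interval_cases r <;> push_cast <;> norm_num <;> ring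
    rw [this]
    ring

lemma bw_range_pair (h : ℕ) (S : ℕ → ℝ) : ∑ r ∈ Finset.range (2 * h + 1), S r =
    ∑ i ∈ Finset.range h, (S (i + 1) + S (2 * h - i)) + S 0 := by
  rw [Finset.sum_range_succ', show 2 * h = h + h by ring, Finset.sum_range_add,
    Finset.sum_add_distrib]
  congr 2
  rw [← Finset.sum_range_reflect]
  refine Finset.sum_congr rfl fun i hi => ?_
  have := Finset.mem_range.1 hi
  congr 1
  omega

lemma bw_pent_nat (n : ℤ) : ∃ e : ℕ, (2 * e : ℤ) = n * (3 * n - 1) := by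
  have h1 : 0 ≤ n * (3 * n - 1) := by
    rcases le_or_gt n 0 with h | h
    · nlinarith
    · nlinarith
  have h2 : (2 : ℤ) ∣ n * (3 * n - 1) := by
    rcases Int.even_or_odd n with ⟨k, hk⟩ | ⟨k, hk⟩
    · exact ⟨k * (3 * n - 1), by rw [hk]; ring⟩
    · exact ⟨n * (3 * k + 1), by rw [hk]; ring⟩
  obtain ⟨k, hk⟩ := h2
  exact ⟨k.toNat, by rw [hk, Int.toNat_of_nonneg (by omega)]⟩

/-- The component series. -/
noncomputable def bwQ (p c : ℕ) (x : ℝ) : ℝ :=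
  if c = 0 then bwA (x ^ p) (x ^ p) else
  (bwA (x ^ p) (x ^ p) * (bwA (x ^ (p + 2 * c)) (x ^ (2 * p)) * bwA (x ^ (p - 2 * c)) (x ^ (2 * p)))) *
    (bwA (-x ^ c) (x ^ p) * bwA (-x ^ (p - c)) (x ^ p))

lemma bwQ_nn (p c : ℕ) (hp : 0 < p) (hc : 2 * c < p) : bwNN (fun x => bwQ p c x / bwA x x) := by
  by_cases h : c = 0
  · simp only [bwQ, h, if_true]
    refine bwNN_quot _ _ (bwHP_ap p p hp) ?_
    rintro ⟨n, hn⟩; omega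
  · have key : ∀ z : ℤ, 2 * (c : ℤ) = p * z → False := by
      intro z hz
      have : (p : ℤ) ∣ 2 * c := ⟨z, hz⟩
      have := Int.le_of_dvd (by omega) this
      omega
    have h1 := bwNN_quot _ _ (bwHP_union _ _ _ _ (bwHP_ap p p hp)
      (bwHP_union _ _ _ _ (bwHP_ap (2 * p) (p + 2 * c) (by omega))
        (bwHP_ap (2 * p) (p - 2 * c) (by omega)) ?_) ?_) ?_
    · refine (h1.mul ((bwNN_plus c p (by omega) hp).mul (bwNN_plus (p - c) p (by omega) hp))).congr ?_
      intro x _ _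
      simp only [bwQ, h, if_false]
      ring
    · rintro j ⟨n, hn⟩ ⟨k, hk⟩
      refine key (k - n) ?_
      zify [hc.le] at hn hk
      linarith
    · rintro j ⟨n, hn⟩ (⟨k, hk⟩ | ⟨k, hk⟩)
      · refine key (n - 2 * k) ?_
        zify at hn hk
        linarith
      · refine key (2 * k - n) ?_
        zify [hc.le] at hn hk
        linarith
    · rintro (⟨n, hn⟩ | ⟨k, hk⟩ | ⟨k, hk⟩) <;> omega

lemma bw_penta_eps (x : ℝ) (h0 : 0 < x) (h1 : x < 1) (ε : ℤ) (hε : ε = 1 ∨ ε = -1) :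
    HasSum (fun k : ℤ => (-1 : ℝ) ^ k * x ^ ((3 * (k : ℝ) ^ 2 - ε * k) / 2)) (bwA x x) := by
  rcases hε with rfl | rfl
  · simpa using bw_penta x h0 h1
  · simpa using bw_penta_neg x h0 h1

lemma bw_big (p : ℕ) (hp : p.Prime) (u h : ℕ) (ε : ℤ) (hε : ε = 1 ∨ ε = -1) (hpu : (p : ℤ) = 6 * u + ε)
    (hph : p = 2 * h + 1) (hp5 : 5 ≤ p) (c : ℕ → ℤ)
    (hc : ∀ q : ℂ, ‖q‖ < 1 →
      HasSum (fun n : ℕ => (c n : ℂ) * q ^ n)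
        (∏' n : ℕ, if p ∣ (n + 1) then 1 else (1 - q ^ (n + 1)))) :
    ∀ n, 0 ≤ c n * c (n + p) := by
  have hp0 : 0 < p := by omega
  have hodd : Odd p := ⟨h, hph⟩
  have hε2 : ε * ε = 1 := by rcases hε with rfl | rfl <;> norm_num
  have hex : ∀ i : ℕ, ∃ e : ℕ, (2 * e : ℤ) = 3 * ((i : ℤ) - u) ^ 2 - ε * (i - u) := by
    intro i
    obtain ⟨e, he⟩ := bw_pent_nat (ε * (i - u))
    refine ⟨e, ?_⟩
    rw [he]
    linear_combination (3 * ((i : ℤ) - u) ^ 2) * hε2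
  choose e he using hex
  have hpuR : (p : ℝ) = 6 * u + ε := by exact_mod_cast hpu
  have heR : ∀ i : ℕ, (e i : ℝ) = (3 * ((i : ℝ) - u) ^ 2 - ε * (i - u)) / 2 := by
    intro i
    have : (2 * e i : ℝ) = 3 * ((i : ℝ) - u) ^ 2 - ε * (i - u) := by exact_mod_cast he i
    linarith
  refine bw_comb p hp0 c (Finset.range (h + 1)) (fun i => (-1) ^ ((i : ℤ) - u)) e
    (fun i x => bwQ p i x / bwA x x) ?_ ?_ ?_
  · intro i hi
    have := Finset.mem_range.1 hi
    exact bwQ_nn p i hp0 (by omega)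
  · intro i hi j hj hm
    have hi' := Finset.mem_range.1 hi
    have hj' := Finset.mem_range.1 hj
    have d1 : (p : ℤ) ∣ (e j : ℤ) - e i := Nat.modEq_iff_dvd.1 hm
    have d2 : (p : ℤ) ∣ 3 * (((j : ℤ) - i) * (j + i)) := by
      obtain ⟨k, hk⟩ := d1
      refine ⟨2 * k + (j - i), ?_⟩
      have h1 := he i
      have h2 := he j
      linear_combination h2 * (-1) + h1 + 2 * hk - (j - i : ℤ) * hpu
    have hpI : Prime (p : ℤ) := Nat.prime_iff_prime_int.1 hp
    rcases hpI.dvd_or_dvd d2 with d | d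
    · have := Int.le_of_dvd (by norm_num) d
      omega
    · rcases hpI.dvd_or_dvd d with d | d
      · have := Int.eq_zero_of_abs_lt_dvd d (by rw [abs_lt]; omega)
        omega
      · have := Int.eq_zero_of_abs_lt_dvd d (by rw [abs_lt]; omega)
        omega
  · intro x h0 h1
    have X0 : 0 < x ^ p := pow_pos h0 _
    have X1 : x ^ p < 1 := pow_lt_one₀ h0.le h1 hp0.ne'
    have hv := bw_real p c hc x _ (by rw [abs_of_pos h0]; exact h1) (bw_val p hp0 x h0 h1)
    convert hv using 1
    have hf := (Equiv.subRight (u : ℤ)).hasSum_iff.2 (bw_penta_eps x h0 h1 ε hε)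
    obtain ⟨hsm, hcl⟩ := bw_classes p hp0 _ _ hf
    -- the terms
    have term : ∀ m : ℤ, ((fun k : ℤ => (-1 : ℝ) ^ k * x ^ ((3 * (k : ℝ) ^ 2 - ε * k) / 2)) ∘
        (Equiv.subRight (u : ℤ))) m =
        (-1 : ℝ) ^ (m - u) * x ^ ((3 * ((m : ℝ) - u) ^ 2 - ε * (m - u)) / 2) := by
      intro m
      simp only [Function.comp, Equiv.subRight_apply]
      push_cast
      rfl
    simp only [term] at hsm hcl
    have XR : ∀ t : ℝ, (x ^ p) ^ t = x ^ (p * t) := by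
      intro t
      rw [← Real.rpow_natCast x p, ← Real.rpow_mul h0.le]
    have plus : ∀ (i : ℕ) (j : ℤ), (-1 : ℝ) ^ ((i : ℤ) + p * j - u) *
        x ^ ((3 * ((((i : ℤ) + p * j : ℤ) : ℝ) - u) ^ 2 - ε * ((((i : ℤ) + p * j : ℤ) : ℝ) - u)) / 2) =
        ((-1) ^ ((i : ℤ) - u) * x ^ e i) *
          ((-1) ^ j * (x ^ p) ^ (p * (3 * (j : ℝ) ^ 2 - j) / 2 + 3 * i * j)) := by
      intro i j
      rw [show (i : ℤ) + p * j - u = i - u + p * j by ring, bw_sign p hodd, XR,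
        mul_mul_mul_comm, ← Real.rpow_natCast x (e i), ← Real.rpow_add h0, heR]
      congr 2
      push_cast
      linear_combination ((p : ℝ) * j / 2) * hpuR
    have minus : ∀ (i : ℕ) (j : ℤ), (-1 : ℝ) ^ (-(i : ℤ) + p * (-j) - u) *
        x ^ ((3 * (((-(i : ℤ) + p * (-j) : ℤ) : ℝ) - u) ^ 2 - ε * (((-(i : ℤ) + p * (-j) : ℤ) : ℝ) - u)) / 2) =
        ((-1) ^ ((i : ℤ) - u) * x ^ e i) *
          ((-1) ^ j * (x ^ p) ^ (p * (3 * (j : ℝ) ^ 2 + j) / 2 + i * (3 * j + 1))) := by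
      intro i j
      have s1 : (-1 : ℝ) ^ (-(i : ℤ) - u) = (-1) ^ ((i : ℤ) - u) := by
        rw [zpow_sub₀ (by norm_num), zpow_sub₀ (by norm_num), zpow_neg, ← inv_zpow]
        norm_num
      have s2 : (-1 : ℝ) ^ (-j) = (-1) ^ j := by
        rw [zpow_neg, ← inv_zpow]
        norm_num
      rw [show -(i : ℤ) + p * (-j) - u = -i - u + p * (-j) by ring, bw_sign p hodd, XR, s1, s2,
        mul_mul_mul_comm, ← Real.rpow_natCast x (e i), ← Real.rpow_add h0, heR]
      congr 2
      push_cast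
      linear_combination (-(p : ℝ) * j / 2 - i) * hpuR
    let f : ℤ → ℝ := fun m => (-1 : ℝ) ^ (m - u) * x ^ ((3 * ((m : ℝ) - u) ^ 2 - ε * (m - u)) / 2)
    have hcl' : bwA x x = ∑ r ∈ Finset.range p, ∑' j : ℤ, f ((r : ℤ) + p * j) := hcl
    have hsm' : ∀ r : ℤ, Summable (fun j : ℤ => f (r + p * j)) := hsm
    have S0 : ∑' j : ℤ, f (((0 : ℕ) : ℤ) + p * j) =
        (-1) ^ (((0 : ℕ) : ℤ) - u) * x ^ e 0 * bwQ p 0 (x ^ p) := by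
      have t := bw_penta ((x ^ p) ^ p) (pow_pos X0 _) (pow_lt_one₀ X0.le X1 hp0.ne')
      rw [bwQ, if_pos rfl]
      refine HasSum.tsum_eq ((t.mul_left _).congr_fun fun j => ?_)
      refine (plus 0 j).trans ?_
      congr 2
      rw [← Real.rpow_natCast (x ^ p) p, ← Real.rpow_mul X0.le]
      congr 1
      push_cast
      ring
    have Si : ∀ i ∈ Finset.range h, ∑' j : ℤ, f (((i + 1 : ℕ) : ℤ) + p * j) +
        ∑' j : ℤ, f (((2 * h - i : ℕ) : ℤ) + p * j) =
        (-1) ^ (((i + 1 : ℕ) : ℤ) - u) * x ^ e (i + 1) * bwQ p (i + 1) (x ^ p) := by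
      intro i hi
      have hi' := Finset.mem_range.1 hi
      have e1 : ∑' j : ℤ, f (((2 * h - i : ℕ) : ℤ) + p * j) =
          ∑' j : ℤ, f (-((i + 1 : ℕ) : ℤ) + p * (-j)) := by
        rw [← (Equiv.subLeft (-1 : ℤ)).tsum_eq]
        refine tsum_congr fun j => ?_
        congr 1
        rw [Equiv.subLeft_apply, hph, Nat.cast_sub (by omega)]
        push_cast
        ring
      have sm2 : Summable (fun j : ℤ => f (-((i + 1 : ℕ) : ℤ) + p * (-j))) :=
        (Equiv.neg ℤ).summable_iff.2 (hsm' (-((i + 1 : ℕ) : ℤ)))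
      rw [e1, ← (hsm' ((i + 1 : ℕ) : ℤ)).tsum_add sm2]
      have t := bw_quint (x ^ p) X0 X1 p ((i + 1 : ℕ) : ℝ) (by exact_mod_cast hp0)
      have n1 : (x ^ p) ^ (p : ℝ) = (x ^ p) ^ p := Real.rpow_natCast _ _
      have n2 : (x ^ p) ^ (((i + 1 : ℕ) : ℝ)) = (x ^ p) ^ (i + 1) := Real.rpow_natCast _ _
      have n3 : (x ^ p) ^ ((p : ℝ) - ((i + 1 : ℕ) : ℝ)) = (x ^ p) ^ (p - (i + 1)) := by
        rw [← Real.rpow_natCast (x ^ p) (p - (i + 1)), Nat.cast_sub (by omega)]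
      have n4 : (x ^ p) ^ ((p : ℝ) + 2 * ((i + 1 : ℕ) : ℝ)) = (x ^ p) ^ (p + 2 * (i + 1)) := by
        rw [← Real.rpow_natCast (x ^ p) (p + 2 * (i + 1))]; congr 1; push_cast; ring
      have n5 : (x ^ p) ^ ((p : ℝ) - 2 * ((i + 1 : ℕ) : ℝ)) = (x ^ p) ^ (p - 2 * (i + 1)) := by
        rw [← Real.rpow_natCast (x ^ p) (p - 2 * (i + 1)), Nat.cast_sub (by omega)]; congr 1; push_cast; ring
      have n6 : (x ^ p) ^ (2 * (p : ℝ)) = (x ^ p) ^ (2 * p) := by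
        rw [← Real.rpow_natCast (x ^ p) (2 * p)]; congr 1; push_cast; ring
      rw [n1, n2, n3, n4, n5, n6] at t
      rw [mul_right_comm] at t
      rw [bwQ, if_neg (Nat.succ_ne_zero i)]
      refine HasSum.tsum_eq ((t.mul_left _).congr_fun fun j => ?_)
      refine (congrArg₂ (· + ·) (plus (i + 1) j) (minus (i + 1) j)).trans ?_
      ring
    rw [hcl', hph, bw_range_pair h (fun r => ∑' j : ℤ, f ((r : ℤ) + (2 * h + 1 : ℕ) * j)), ← hph,
      Finset.sum_congr rfl Si, S0, Finset.sum_range_succ', add_div, Finset.sum_div]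
    congr 1
    · refine Finset.sum_congr rfl fun i _ => ?_
      ring
    · ring

theorem borwein_sign_pattern (p : ℕ) (hp : p.Prime) (c : ℕ → ℤ)
    (hc : ∀ q : ℂ, ‖q‖ < 1 →
      HasSum (fun n : ℕ => (c n : ℂ) * q ^ n)
        (∏' n : ℕ, if p ∣ (n + 1) then 1 else (1 - q ^ (n + 1)))) :
    ∀ n : ℕ, 0 ≤ c n * c (n + p) := by
  have h2 := hp.two_le
  by_cases e2 : p = 2
  · subst e2; exact bw_two c hc
  by_cases e3 : p = 3
  · subst e3; exact bw_three c hc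
  have m2 : p % 2 ≠ 0 := fun h => e2 ((Nat.prime_dvd_prime_iff_eq Nat.prime_two hp).1 (Nat.dvd_of_mod_eq_zero h)).symm
  have m3 : p % 3 ≠ 0 := fun h => e3 ((Nat.prime_dvd_prime_iff_eq Nat.prime_three hp).1 (Nat.dvd_of_mod_eq_zero h)).symm
  rcases (by omega : p % 6 = 1 ∨ p % 6 = 5) with h | h
  · exact bw_big p hp (p / 6) (p / 2) 1 (Or.inl rfl) (by omega) (by omega) (by omega) c hc
  · exact bw_big p hp (p / 6 + 1) (p / 2) (-1) (Or.inr rfl) (by omega) (by omega) (by omega) c hc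
end

section
/- Let p be a prime and let c_p^{(3)} : ℕ → ℤ be the coefficient sequence of the cube of the infinite Borwein product. Then for every integer n ≥ 0 one has c_p^{(3)}(n) · c_p^{(3)}(n+p) ≥ 0, i.e. the coefficients c_p^{(3)}(n) and c_p^{(3)}(n+p) have the same sign. -/
namespace CubicBorwein

section Ring
variable {S : Type*} [CommRing S]

/-- finite q-Pochhammer -/
def poch (x Q : S) (N : ℕ) : S := ∏ i ∈ Finset.range N, (1 - x * Q ^ i)

/-- q-binomial coefficients -/
def qb (Q : S) : ℕ → ℕ → S
  | _, 0 => 1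
  | 0, _ + 1 => 0
  | n + 1, k + 1 => qb Q n (k + 1) + Q ^ (n - k) * qb Q n k

theorem qb_zero (Q : S) (n : ℕ) : qb Q n 0 = 1 := by cases n <;> rfl

theorem qb_succ (Q : S) (n k : ℕ) :
    qb Q (n + 1) (k + 1) = qb Q n (k + 1) + Q ^ (n - k) * qb Q n k := rfl

theorem qb_lt (Q : S) : ∀ n k : ℕ, n < k → qb Q n k = 0 := by
  intro n
  induction n with
  | zero => intro k hk; obtain ⟨k, rfl⟩ : ∃ j, k = j + 1 := ⟨k - 1, by omega⟩; rfl
  | succ n ih =>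
    intro k hk
    obtain ⟨k, rfl⟩ : ∃ j, k = j + 1 := ⟨k - 1, by omega⟩
    rw [qb_succ, ih _ (by omega), ih _ (by omega)]; simp

theorem qb_succ' (Q : S) : ∀ n k : ℕ,
    qb Q (n + 1) (k + 1) = qb Q n k + Q ^ (k + 1) * qb Q n (k + 1) := by
  intro n
  induction n with
  | zero =>
    intro k
    cases k with
    | zero => simp [qb]
    | succ k => simp [qb]
  | succ n ih =>
    intro k
    rw [qb_succ Q (n + 1) k]
    cases k with
    | zero =>
      have h1 := ih 0
      have h2 := qb_succ Q n 0
      simp only [qb_zero, Nat.sub_zero, zero_add, pow_one] at *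
      rw [h1]
      have : Q ^ (n + 1) = Q * Q ^ n := by ring
      rw [this]
      linear_combination Q * h1 - Q * h2
    | succ k =>
      by_cases hk : k + 1 ≤ n
      · have h1 := ih (k + 1)
        have h2 := ih k
        have h3 := qb_succ Q n (k + 1)
        have h4 := qb_succ Q n k
        obtain ⟨d, rfl⟩ : ∃ d, n = k + 1 + d := ⟨n - (k + 1), by omega⟩
        have e1 : k + 1 + d + 1 - (k + 1) = d + 1 := by omega
        have e2 : k + 1 + d - (k + 1) = d := by omega
        have e3 : k + 1 + d - k = d + 1 := by omega
        rw [e1]; rw [e2] at h3; rw [e3] at h4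
        linear_combination h1 + Q ^ (d + 1) * h2 - h4 - Q ^ (k + 2) * h3
      · have e : n + 1 - (k + 1) = 0 := by omega
        rw [e, qb_lt Q (n + 1) (k + 1 + 1) (by omega)]; simp

theorem qb_mul (Q : S) : ∀ n k : ℕ, k ≤ n →
    qb Q n k * poch Q Q k = ∏ i ∈ Finset.range k, (1 - Q ^ (n - i)) := by
  intro n
  induction n with
  | zero => intro k hk; obtain rfl : k = 0 := by omega
            simp [qb, poch]
  | succ n ih =>
    intro k hk
    cases k with
    | zero => simp [qb, poch]
    | succ k =>
      have h2 := ih k (by omega)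
      rw [Finset.prod_range_succ']
      have e : ∀ i, n + 1 - (i + 1) = n - i := fun i => by omega
      simp only [e, Nat.sub_zero]
      rw [← h2, qb_succ]
      have hp : poch Q Q (k + 1) = poch Q Q k * (1 - Q * Q ^ k) := Finset.prod_range_succ _ _
      have h1 : qb Q n (k + 1) * poch Q Q (k + 1) = qb Q n k * poch Q Q k * (1 - Q ^ (n - k)) := by
        by_cases hk' : k + 1 ≤ n
        · rw [ih _ hk', Finset.prod_range_succ, h2]
        · have : n - k = 0 := by omega
          rw [qb_lt Q n _ (by omega), this]; simp
      rw [add_mul, h1, hp]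
      have : Q ^ (n + 1) = Q ^ (n - k) * (Q * Q ^ k) := by
        rw [← pow_succ', ← pow_add]; congr 1; omega
      rw [this]; ring

/-- theta term -/
def tt (x y : S) (m : ℤ) : S :=
  if 0 ≤ m then (-x) ^ m.toNat * (x * y) ^ (m.toNat.choose 2)
  else (-y) ^ (-m).toNat * (x * y) ^ ((-m).toNat.choose 2)

theorem tt_nat (x y : S) (m : ℕ) : tt x y m = (-x) ^ m * (x * y) ^ (m.choose 2) := by
  simp [tt]

theorem tt_neg (x y : S) (m : ℕ) : tt x y (-m) = (-y) ^ m * (x * y) ^ (m.choose 2) := by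
  cases m with
  | zero => simp [tt]
  | succ m => 
    have : ¬ (0 : ℤ) ≤ -((m + 1 : ℕ) : ℤ) := by push_cast; omega
    rw [tt, if_neg this]; simp

theorem choose2 (m : ℕ) : (m + 1).choose 2 = m + m.choose 2 := by
  rw [Nat.choose_succ_succ' m 1]; simp

theorem tt_x (x y : S) (M : ℕ) (m : ℤ) (h : m ≤ M) :
    -(x * (x * y) ^ M) * tt x y m = (x * y) ^ (M - m).toNat * tt x y (m + 1) := by
  rcases le_or_gt 0 m with h0 | h0
  · obtain ⟨m, rfl⟩ := Int.eq_ofNat_of_zero_le h0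
    have : tt x y ((m : ℤ) + 1) = tt x y ((m + 1 : ℕ) : ℤ) := by push_cast; rfl
    rw [this, tt_nat, tt_nat, choose2]
    obtain ⟨d, rfl⟩ : ∃ d, M = m + d := ⟨M - m, by omega⟩
    have : (((m + d : ℕ) : ℤ) - m).toNat = d := by omega
    rw [this]; ring
  · obtain ⟨k, rfl⟩ : ∃ k : ℕ, m = -((k + 1 : ℕ) : ℤ) := ⟨(-m - 1).toNat, by omega⟩
    have : -((k + 1 : ℕ) : ℤ) + 1 = -(k : ℤ) := by push_cast; ring
    rw [this, tt_neg, tt_neg, choose2]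
    have : ((M : ℤ) - -((k + 1 : ℕ) : ℤ)).toNat = M + k + 1 := by omega
    rw [this]; ring

theorem tt_comm (x y : S) (m : ℤ) : tt x y m = tt y x (-m) := by
  rcases le_or_gt 0 m with h0 | h0
  · obtain ⟨m, rfl⟩ := Int.eq_ofNat_of_zero_le h0
    rw [tt_neg, tt_nat, mul_comm y x]
  · obtain ⟨k, rfl⟩ : ∃ k : ℕ, m = -(k : ℤ) := ⟨(-m).toNat, by omega⟩
    rw [neg_neg, tt_neg, tt_nat, mul_comm y x]

theorem tt_y (x y : S) (N : ℕ) (m : ℤ) (h : -m ≤ N) :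
    -(y * (x * y) ^ N) * tt x y m = (x * y) ^ (N + m).toNat * tt x y (m - 1) := by
  have := tt_x y x N (-m) h
  rw [tt_comm x y m, tt_comm x y (m - 1), mul_comm x y, this]
  congr 2
  · congr 1; ring
  · ring

theorem finite_jtp_x (x y : S) (M N : ℕ)
    (ih : poch x (x * y) M * poch y (x * y) N =
      ∑ k ∈ Finset.range (M + N + 1), qb (x * y) (M + N) k * tt x y (k - N)) :
    poch x (x * y) (M + 1) * poch y (x * y) N =
      ∑ k ∈ Finset.range (M + N + 2), qb (x * y) (M + N + 1) k * tt x y (k - N) := by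
  have hp : poch x (x * y) (M + 1) = poch x (x * y) M * (1 - x * (x * y) ^ M) :=
    Finset.prod_range_succ _ _
  have h1 : poch x (x * y) (M + 1) * poch y (x * y) N =
      (poch x (x * y) M * poch y (x * y) N) +
      (-(x * (x * y) ^ M)) * (poch x (x * y) M * poch y (x * y) N) := by rw [hp]; ring
  rw [h1, ih, Finset.mul_sum, Finset.sum_range_succ' _ (M + N + 1)]
  have h2 : ∑ k ∈ Finset.range (M + N + 1), qb (x * y) (M + N) k * tt x y (k - N) =
      ∑ k ∈ Finset.range (M + N + 1), qb (x * y) (M + N) (k + 1) * tt x y ((k + 1 : ℕ) - N)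
       + qb (x * y) (M + N + 1) 0 * tt x y ((0 : ℕ) - N) := by
    rw [qb_zero, ← qb_zero (x * y) (M + N), ← Finset.sum_range_succ' 
      (fun k : ℕ => qb (x * y) (M + N) k * tt x y (k - N)), Finset.sum_range_succ _ (M + N + 1),
      qb_lt _ _ (M + N + 1) (by omega)]
    simp
  rw [h2, add_right_comm, ← Finset.sum_add_distrib]
  congr 1
  apply Finset.sum_congr rfl
  intro k hk
  rw [Finset.mem_range] at hk
  rw [qb_succ, mul_left_comm, tt_x x y M _ (by omega)]
  have : ((M : ℤ) - (k - N)).toNat = M + N - k := by omega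
  rw [this]
  have : (k : ℤ) - N + 1 = ((k + 1 : ℕ) : ℤ) - N := by push_cast; ring
  rw [this]; ring

theorem finite_jtp_y (x y : S) (M N : ℕ)
    (ih : poch x (x * y) M * poch y (x * y) N =
      ∑ k ∈ Finset.range (M + N + 1), qb (x * y) (M + N) k * tt x y (k - N)) :
    poch x (x * y) M * poch y (x * y) (N + 1) =
      ∑ k ∈ Finset.range (M + N + 2), qb (x * y) (M + N + 1) k * tt x y (k - (N + 1 : ℕ)) := by
  have hp : poch y (x * y) (N + 1) = poch y (x * y) N * (1 - y * (x * y) ^ N) :=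
    Finset.prod_range_succ _ _
  have h1 : poch x (x * y) M * poch y (x * y) (N + 1) =
      (-(y * (x * y) ^ N)) * (poch x (x * y) M * poch y (x * y) N) + 
      (poch x (x * y) M * poch y (x * y) N) := by rw [hp]; ring
  rw [h1, ih, Finset.mul_sum, Finset.sum_range_succ' _ (M + N + 1)]
  have h2 : ∑ k ∈ Finset.range (M + N + 1), 
        -(y * (x * y) ^ N) * (qb (x * y) (M + N) k * tt x y (k - N)) =
      ∑ k ∈ Finset.range (M + N + 1), (x * y) ^ (k + 1) * qb (x * y) (M + N) (k + 1) 
          * tt x y ((k + 1 : ℕ) - (N + 1 : ℕ))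
       + qb (x * y) (M + N + 1) 0 * tt x y ((0 : ℕ) - (N + 1 : ℕ)) := by
    have : qb (x * y) (M + N + 1) 0 * tt x y ((0 : ℕ) - (N + 1 : ℕ)) = 
      (x * y) ^ 0 * qb (x * y) (M + N) 0 * tt x y ((0 : ℕ) - (N + 1 : ℕ)) := by simp [qb_zero]
    rw [this, ← Finset.sum_range_succ' 
      (fun k : ℕ => (x * y) ^ k * qb (x * y) (M + N) k * tt x y (k - (N + 1 : ℕ))),
      Finset.sum_range_succ _ (M + N + 1),
      qb_lt _ _ (M + N + 1) (by omega)]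
    simp only [mul_zero, zero_mul, add_zero]
    apply Finset.sum_congr rfl
    intro k hk
    rw [mul_left_comm, tt_y x y N _ (by omega)]
    have : ((N : ℤ) + (k - N)).toNat = k := by omega
    rw [this]
    have : (k : ℤ) - N - 1 = (k : ℤ) - (N + 1 : ℕ) := by push_cast; ring
    rw [this]; ring
  rw [h2, add_right_comm, ← Finset.sum_add_distrib]
  congr 1
  apply Finset.sum_congr rfl
  intro k hk
  rw [qb_succ']
  have : (k : ℤ) - N = ((k + 1 : ℕ) : ℤ) - (N + 1 : ℕ) := by push_cast; ring
  rw [this]; ring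

theorem finite_jtp (x y : S) (M N : ℕ) :
    poch x (x * y) M * poch y (x * y) N =
      ∑ k ∈ Finset.range (M + N + 1), qb (x * y) (M + N) k * tt x y (k - N) := by
  induction M with
  | succ M ih =>
    have := finite_jtp_x x y M N ih
    rw [this, show M + 1 + N = M + N + 1 by ring]
  | zero =>
    induction N with
    | zero => simp [poch, qb, tt]
    | succ N ih => exact finite_jtp_y x y 0 N ih

theorem prod_one_sub_dvd (Q : S) (r : ℕ) (s : Finset ℕ) (f : ℕ → ℕ) (h : ∀ i ∈ s, r ≤ f i) :
    Q ^ r ∣ (∏ i ∈ s, (1 - Q ^ f i)) - 1 := by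
  classical
  induction s using Finset.induction_on with
  | empty => simp
  | insert a s ha ih =>
    rw [Finset.prod_insert ha]
    have h1 := ih (fun i hi => h i (Finset.mem_insert_of_mem hi))
    have h2 : Q ^ r ∣ Q ^ f a := pow_dvd_pow _ (h a (Finset.mem_insert_self _ _))
    have : (1 - Q ^ f a) * ∏ i ∈ s, (1 - Q ^ f i) - 1 =
      ((∏ i ∈ s, (1 - Q ^ f i)) - 1) - Q ^ f a * ∏ i ∈ s, (1 - Q ^ f i) := by ring
    rw [this]
    exact dvd_sub h1 (h2.mul_right _)

theorem poch_self_split (Q : S) (k d : ℕ) : ∃ v, poch Q Q (k + d) = poch Q Q k * v ∧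
    Q ^ (k + 1) ∣ v - 1 := by
  refine ⟨∏ i ∈ Finset.range d, (1 - Q ^ (k + i + 1)), ?_, ?_⟩
  · unfold poch
    rw [Finset.prod_range_add]
    congr 1
    apply Finset.prod_congr rfl
    intro i _
    rw [pow_succ']
  · exact prod_one_sub_dvd _ _ _ _ (fun i _ => by omega)

theorem poch_qb (Q : S) (N k : ℕ) (hk : k ≤ 2 * N) :
    Q ^ (min k (2 * N - k) + 1) ∣ poch Q Q N * qb Q (2 * N) k - 1 := by
  have h0 : Q ^ (min k (2 * N - k) + 1) ∣ qb Q (2 * N) k * poch Q Q k - 1 := by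
    rw [qb_mul Q _ _ hk]
    apply prod_one_sub_dvd
    intro i hi
    rw [Finset.mem_range] at hi
    omega
  rcases le_total k N with h | h
  · obtain ⟨d, rfl⟩ := Nat.exists_eq_add_of_le h
    obtain ⟨v, hv, hd⟩ := poch_self_split Q k d
    rw [hv]
    have : poch Q Q k * v * qb Q (2 * (k + d)) k - 1 = 
      (qb Q (2 * (k + d)) k * poch Q Q k) * (v - 1) + (qb Q (2 * (k + d)) k * poch Q Q k - 1) := by
      ring
    rw [this]
    exact dvd_add (((pow_dvd_pow _ (by omega)).trans hd).mul_left _) h0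
  · obtain ⟨d, rfl⟩ := Nat.exists_eq_add_of_le h
    obtain ⟨v, hv, hd⟩ := poch_self_split Q N d
    rw [hv] at h0
    set b := qb Q (2 * N) (N + d)
    have : poch Q Q N * b - 1 = (b * (poch Q Q N * v) - 1) - poch Q Q N * b * (v - 1) := by ring
    rw [this]
    exact dvd_sub h0 (((pow_dvd_pow _ (by omega)).trans hd).mul_left _)

theorem tt_dvd (x y : S) (m : ℤ) : (x * y) ^ (m.natAbs.choose 2) ∣ tt x y m := by
  rcases le_or_gt 0 m with h0 | h0
  · obtain ⟨m, rfl⟩ := Int.eq_ofNat_of_zero_le h0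
    rw [tt_nat]; simp
  · obtain ⟨k, rfl⟩ : ∃ k : ℕ, m = -(k : ℤ) := ⟨(-m).toNat, by omega⟩
    rw [tt_neg]; simp

theorem choose2_ge (m : ℕ) : m ≤ m.choose 2 + 1 := by
  induction m with
  | zero => simp
  | succ m ih => rw [choose2]; rcases m with _ | m
                 · simp
                 · omega

theorem jtp_mod (x y : S) (N : ℕ) :
    (x * y) ^ N ∣ poch (x * y) (x * y) N * poch x (x * y) N * poch y (x * y) N -
      ∑ k ∈ Finset.range (2 * N + 1), tt x y (k - N) := by
  rw [mul_assoc, finite_jtp, ← two_mul, Finset.mul_sum, ← Finset.sum_sub_distrib]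
  apply Finset.dvd_sum
  intro k hk
  rw [Finset.mem_range] at hk
  have h1 := poch_qb (x * y) N k (by omega)
  have h2 := tt_dvd x y (k - N)
  have h3 := mul_dvd_mul h1 h2
  rw [← pow_add] at h3
  have : poch (x * y) (x * y) N * (qb (x * y) (2 * N) k * tt x y (k - N)) - tt x y (k - N) =
    (poch (x * y) (x * y) N * qb (x * y) (2 * N) k - 1) * tt x y (k - N) := by ring
  rw [this]
  refine (pow_dvd_pow _ ?_).trans h3
  have := choose2_ge ((k : ℤ) - N).natAbs
  omega

end Ring
end CubicBorwein
namespace CubicBorwein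
section Dual
variable {R : Type*} [CommRing R]
open TrivSqZeroExt

theorem snd_mul' (a b : TrivSqZeroExt R R) : (a * b).snd = a.fst * b.snd + a.snd * b.fst := by
  rw [TrivSqZeroExt.snd_mul]; simp [mul_comm]

/-- exponent of the theta term -/
def ex (A B : ℕ) (m : ℤ) : ℕ :=
  (if 0 ≤ m then A else B) * m.natAbs + (A + B) * (m.natAbs.choose 2)

/-- `q^A (1 + c ε)` -/
def dl (q : R) (A : ℕ) (c : R) : TrivSqZeroExt R R := inl (q ^ A) * (1 + inr c)

theorem dl_fst (q : R) (A : ℕ) (c : R) : (dl q A c).fst = q ^ A := by simp [dl]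
theorem dl_snd (q : R) (A : ℕ) (c : R) : (dl q A c).snd = q ^ A * c := by simp [dl]

theorem dl_mul (q : R) (A B : ℕ) (c d : R) : dl q A c * dl q B d = dl q (A + B) (c + d) := by
  ext
  · simp only [fst_mul, dl_fst, pow_add]
  · simp only [snd_mul', dl_fst, dl_snd, pow_add]; ring

theorem dl_pow (q : R) (A : ℕ) (c : R) (n : ℕ) : dl q A c ^ n = dl q (A * n) (n * c) := by
  induction n with
  | zero => ext <;> simp [dl]
  | succ n ih => rw [pow_succ, ih, dl_mul]; congr 1; push_cast; ring

theorem tt_dl_nat (q : R) (A B : ℕ) (c : R) (m : ℕ) :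
    (-dl q A c) ^ m * (dl q A c * dl q B (-c)) ^ (m.choose 2) = 
    (-1) ^ m * dl q (A * m + (A + B) * m.choose 2) (m * c) := by
  rw [neg_pow, dl_mul, dl_pow, dl_pow, mul_assoc, dl_mul]; simp

theorem tt_dl (q : R) (A B : ℕ) (m : ℤ) :
    tt (dl q A 1) (dl q B (-1)) m = (-1) ^ m.natAbs * dl q (ex A B m) (m : R) := by
  rcases le_or_gt 0 m with h0 | h0
  · obtain ⟨m, rfl⟩ := Int.eq_ofNat_of_zero_le h0
    rw [tt_nat, tt_dl_nat]; simp [ex]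
  · obtain ⟨k, rfl⟩ : ∃ k : ℕ, m = -(k : ℤ) := ⟨(-m).toNat, by omega⟩
    have := tt_dl_nat q B A (-1) k
    rw [neg_neg] at this
    rw [tt_neg, mul_comm (dl q A 1), this]
    have : ¬ (0 : ℤ) ≤ -(k : ℤ) := by omega
    simp only [ex, if_neg this]
    simp [add_comm]

theorem neg_one_pow_fst (n : ℕ) : ((-1 : TrivSqZeroExt R R) ^ n).fst = (-1) ^ n := by
  rcases Nat.even_or_odd n with h' | h' <;> simp [h'.neg_one_pow]

theorem neg_one_pow_snd (n : ℕ) : ((-1 : TrivSqZeroExt R R) ^ n).snd = 0 := by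
  rcases Nat.even_or_odd n with h' | h' <;> simp [h'.neg_one_pow]

theorem poch_fst (q : R) (A P : ℕ) (c : R) (N : ℕ) :
    (poch (dl q A c) (dl q P 0) N).fst = poch (q ^ A) (q ^ P) N := by
  induction N with
  | zero => simp [poch]
  | succ N ih =>
    unfold poch at *
    rw [Finset.prod_range_succ, Finset.prod_range_succ, fst_mul, ih]
    simp [dl_fst]

theorem poch_snd (q : R) (g : ℕ → R) (hg : ∀ n, 1 ≤ n → g n * (1 - q ^ n) = 1)
    (A P : ℕ) (hA : 1 ≤ A) (c : R) (N : ℕ) :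
    (poch (dl q A c) (dl q P 0) N).snd = - (c * poch (q ^ A) (q ^ P) N *
      ∑ i ∈ Finset.range N, q ^ (A + P * i) * g (A + P * i)) := by
  induction N with
  | zero => simp [poch]
  | succ N ih =>
    have h1 : poch (dl q A c) (dl q P 0) (N + 1) = poch (dl q A c) (dl q P 0) N *
      (1 - dl q A c * dl q P 0 ^ N) := Finset.prod_range_succ _ _
    have h2 : poch (q ^ A) (q ^ P) (N + 1) = poch (q ^ A) (q ^ P) N *
      (1 - q ^ A * (q ^ P) ^ N) := Finset.prod_range_succ _ _
    rw [h1, snd_mul', ih, poch_fst, h2, Finset.sum_range_succ, dl_pow, dl_mul]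
    simp only [snd_sub, fst_sub, dl_fst, dl_snd, snd_one, fst_one]
    have h3 := hg (A + P * N) (by omega)
    have h4 : q ^ A * (q ^ P) ^ N = q ^ (A + P * N) := by rw [← pow_mul, ← pow_add]
    rw [h4]
    set a := q ^ (A + P * N)
    simp only [mul_zero, add_zero]
    linear_combination a * c * poch (q ^ A) (q ^ P) N * h3

theorem dl_dvd (q : R) (P N : ℕ) (s : TrivSqZeroExt R R) (h : dl q P 0 ^ N ∣ s) (α β : R) :
    q ^ (P * N) ∣ α * s.fst + β * s.snd := by
  obtain ⟨t, rfl⟩ := h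
  rw [dl_pow, fst_mul, snd_mul', dl_fst, dl_snd]
  exact ⟨α * t.fst + β * t.snd, by ring⟩

theorem theta_gen (q : R) (A B N : ℕ) (α β : R) :
    q ^ ((A + B) * N) ∣ 
      (α * (poch (q ^ (A + B)) (q ^ (A + B)) N * poch (q ^ A) (q ^ (A + B)) N * 
          poch (q ^ B) (q ^ (A + B)) N) + 
       β * (poch (q ^ (A + B)) (q ^ (A + B)) N * 
        (poch (q ^ A) (q ^ (A + B)) N * (poch (dl q B (-1)) (dl q (A + B) 0) N).snd +
         (poch (dl q A 1) (dl q (A + B) 0) N).snd * poch (q ^ B) (q ^ (A + B)) N))) -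
      ∑ k ∈ Finset.range (2 * N + 1), (-1) ^ ((k : ℤ) - N).natAbs * 
        (α + β * (((k : ℤ) - N : ℤ) : R)) * q ^ (ex A B ((k : ℤ) - N)) := by
  have h := jtp_mod (dl q A 1) (dl q B (-1)) N
  have e : dl q A (1 : R) * dl q B (-1) = dl q (A + B) 0 := by rw [dl_mul]; simp
  rw [e] at h
  have h' := dl_dvd q (A + B) N _ h α β
  have hz : (poch (dl q (A + B) 0) (dl q (A + B) 0) N).snd = 0 := by
    have e : dl q (A + B) (0 : R) = inl (q ^ (A + B)) := by ext <;> simp [dl]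
    rw [e]
    have : poch (inl (q ^ (A + B)) : TrivSqZeroExt R R) (inl (q ^ (A + B))) N = 
       inlHom R R (poch (q ^ (A + B)) (q ^ (A + B)) N) := by
      simp [poch, map_prod]
    rw [this]; simp
  convert h' using 1
  simp only [fst_sub, snd_sub, fst_mul, snd_mul', poch_fst, hz, fst_sum, snd_sum, tt_dl,
    neg_one_pow_fst, neg_one_pow_snd, dl_fst, dl_snd, mul_sub, Finset.mul_sum]
  rw [sub_add_sub_comm, ← Finset.sum_add_distrib]
  congr 1
  · ring
  · apply Finset.sum_congr rfl
    intro k _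
    ring

theorem theta_pos (q : R) (g : ℕ → R) (hg : ∀ n, 1 ≤ n → g n * (1 - q ^ n) = 1)
    (A B N : ℕ) (hA : 1 ≤ A) (hB : 1 ≤ B) (α β : R) :
    q ^ ((A + B) * N) ∣ 
      (poch (q ^ (A + B)) (q ^ (A + B)) N * poch (q ^ A) (q ^ (A + B)) N * 
          poch (q ^ B) (q ^ (A + B)) N) * 
       (α + β * ∑ i ∈ Finset.range N, (q ^ (B + (A + B) * i) * g (B + (A + B) * i) -
          q ^ (A + (A + B) * i) * g (A + (A + B) * i))) -
      ∑ k ∈ Finset.range (2 * N + 1), (-1) ^ ((k : ℤ) - N).natAbs * 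
        (α + β * (((k : ℤ) - N : ℤ) : R)) * q ^ (ex A B ((k : ℤ) - N)) := by
  have h := theta_gen q A B N α β
  rw [poch_snd q g hg A _ hA, poch_snd q g hg B _ hB] at h
  convert h using 2
  rw [Finset.sum_sub_distrib]
  ring

theorem theta_zero (q : R) (A N : ℕ) (α β : R) :
    q ^ (A * (N + 1)) ∣ 
      β * (poch (q ^ A) (q ^ A) (N + 1) * poch (q ^ A) (q ^ A) (N + 1) * poch (q ^ A) (q ^ A) N) -
      ∑ k ∈ Finset.range (2 * (N + 1) + 1), (-1) ^ ((k : ℤ) - (N + 1 : ℕ)).natAbs * 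
        (α + β * (((k : ℤ) - (N + 1 : ℕ) : ℤ) : R)) * q ^ (ex A 0 ((k : ℤ) - (N + 1 : ℕ))) := by
  have h := theta_gen q A 0 (N + 1) α β
  have h1 : poch (q ^ 0) (q ^ (A + 0)) (N + 1) = 0 := by
    unfold poch; rw [Finset.prod_range_succ']; simp
  have h2 : (poch (dl q 0 (-1)) (dl q (A + 0) 0) (N + 1)).snd = poch (q ^ A) (q ^ A) N := by
    have : poch (dl q 0 (-1)) (dl q (A + 0) 0) (N + 1) = poch (dl q A (-1)) (dl q A 0) N * inr 1 := by
      unfold poch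
      rw [Finset.prod_range_succ']
      congr 1
      · apply Finset.prod_congr rfl
        intro i _
        rw [dl_pow, dl_pow, dl_mul, dl_mul]
        congr 2 <;> ring
      · ext <;> simp [dl]
    rw [this, snd_mul', poch_fst]; simp
  rw [h1, h2] at h
  convert h using 2
  simp only [add_zero]
  ring
end Dual
end CubicBorwein
namespace CubicBorwein
open PowerSeries

/-- nonnegative coefficients -/
def NN (f : ℤ⟦X⟧) : Prop := ∀ n, 0 ≤ coeff n f

theorem NN.mul {f g : ℤ⟦X⟧} (hf : NN f) (hg : NN g) : NN (f * g) := by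
  intro n
  rw [coeff_mul]
  exact Finset.sum_nonneg fun i _ => mul_nonneg (hf _) (hg _)

theorem NN.add {f g : ℤ⟦X⟧} (hf : NN f) (hg : NN g) : NN (f + g) := by
  intro n
  rw [map_add]
  exact add_nonneg (hf _) (hg _)

theorem NN.nat (k : ℕ) : NN (k : ℤ⟦X⟧) := by
  intro n
  have : (k : ℤ⟦X⟧) = C (k : ℤ) := by simp
  rw [this, coeff_C]
  split_ifs <;> simp

theorem NN.one : NN (1 : ℤ⟦X⟧) := by simpa using NN.nat 1

theorem NN.X_pow (k : ℕ) : NN (X ^ k : ℤ⟦X⟧) := by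
  intro n; rw [coeff_X_pow]; split_ifs <;> simp

theorem NN.sum {ι : Type*} (s : Finset ι) (f : ι → ℤ⟦X⟧) (h : ∀ i ∈ s, NN (f i)) :
    NN (∑ i ∈ s, f i) := by
  intro n; rw [map_sum]; exact Finset.sum_nonneg fun i hi => h i hi n

theorem NN.prod {ι : Type*} (s : Finset ι) (f : ι → ℤ⟦X⟧) (h : ∀ i ∈ s, NN (f i)) :
    NN (∏ i ∈ s, f i) := 
  Finset.prod_induction f NN (fun _ _ => NN.mul) NN.one h

/-- geometric series `1/(1-X^n)` -/
noncomputable def geo (n : ℕ) : ℤ⟦X⟧ := PowerSeries.mk fun k => if n ∣ k then 1 else 0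

theorem geo_NN (n : ℕ) : NN (geo n) := by
  intro k; rw [geo, coeff_mk]; split_ifs <;> simp

theorem geo_mul (n : ℕ) (hn : 1 ≤ n) : geo n * (1 - X ^ n) = 1 := by
  ext k
  rw [mul_sub, mul_one, map_sub, coeff_mul_X_pow', coeff_one, geo, coeff_mk]
  by_cases h : n ≤ k
  · rw [if_pos h, coeff_mk, if_neg (by omega : ¬ k = 0)]
    have hd : n ∣ k - n ↔ n ∣ k := (Nat.dvd_sub_iff_left h (dvd_refl n))
    simp [hd]
  · rw [if_neg h]
    by_cases hk : k = 0
    · simp [hk]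
    · have : ¬ n ∣ k := fun hd => h (Nat.le_of_dvd (by omega) hd)
      simp [hk, this]

/-- `∏_{n ≤ L} 1/(1-X^{pn})` -/
noncomputable def Pi' (p L : ℕ) : ℤ⟦X⟧ := ∏ n ∈ Finset.Icc 1 L, geo (p * n)

theorem geo_mul' (p : ℕ) (hp : 1 ≤ p) (n : ℕ) (hn : 1 ≤ n) :
    geo (p * n) * (1 - (X ^ p) ^ n) = 1 := by
  rw [← pow_mul]; exact geo_mul _ (Nat.mul_pos hp hn)

theorem sub_NN (p : ℕ) (hp : 1 ≤ p) (L : ℕ) (I : Finset ℕ) (hI : I ⊆ Finset.Icc 1 L) :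
    NN ((∏ n ∈ I, (1 - (X ^ p) ^ n)) * Pi' p L) := by
  have : (∏ n ∈ I, (1 - (X ^ p) ^ n)) * Pi' p L = ∏ n ∈ Finset.Icc 1 L \ I, geo (p * n) := by
    have h1 : ∏ n ∈ I, ((1 - (X ^ p) ^ n) * geo (p * n)) = (1 : ℤ⟦X⟧) := by
      apply Finset.prod_eq_one
      intro n hn
      have := Finset.mem_Icc.1 (hI hn)
      rw [mul_comm, geo_mul' p hp n this.1]
    rw [Pi', ← Finset.prod_sdiff hI, mul_left_comm, ← Finset.prod_mul_distrib, h1, mul_one]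
  rw [this]
  exact NN.prod _ _ fun i _ => geo_NN _

theorem poch_eq (q : ℤ⟦X⟧) (A P N : ℕ) (hP : 1 ≤ P) :
    poch (q ^ A) (q ^ P) N = 
      ∏ n ∈ (Finset.range N).image (fun i => A + P * i), (1 - q ^ n) := by
  rw [Finset.prod_image]
  · unfold poch
    apply Finset.prod_congr rfl
    intro i _
    rw [← pow_mul, ← pow_add]
  · intro i _ j _ h
    have : P * i = P * j := by simpa using h
    exact Nat.eq_of_mul_eq_mul_left hP this

theorem img_sub (A P N L : ℕ) (hA : 1 ≤ A) (hAP : A ≤ P) (hL : P * (N + 1) ≤ L) :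
    (Finset.range N).image (fun i => A + P * i) ⊆ Finset.Icc 1 L := by
  intro n hn
  obtain ⟨i, hi, rfl⟩ := Finset.mem_image.1 hn
  rw [Finset.mem_range] at hi
  rw [Finset.mem_Icc]
  refine ⟨by omega, ?_⟩
  have : P * i ≤ P * N := Nat.mul_le_mul_left _ hi.le
  rw [mul_add] at hL
  omega

theorem poch_NN (p : ℕ) (hp : 1 ≤ p) (A P N L : ℕ) (hA : 1 ≤ A) (hAP : A ≤ P)
    (hL : P * (N + 1) ≤ L) :
    NN (poch ((X ^ p) ^ A) ((X ^ p) ^ P) N * Pi' p L) := by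
  rw [poch_eq _ _ _ _ (by omega)]
  exact sub_NN p hp L _ (img_sub A P N L hA hAP hL)

theorem poch_NN' (p : ℕ) (hp : 1 ≤ p) (A P N L j : ℕ) (hj : 1 ≤ j) (hA : j < A) (hAP : A ≤ P)
    (hL : P * (N + 1) ≤ L) :
    NN ((1 - (X ^ p) ^ j) * poch ((X ^ p) ^ A) ((X ^ p) ^ P) N * Pi' p L) := by
  rw [poch_eq _ _ _ _ (by omega), ← Finset.prod_insert (f := fun n => 1 - ((X : ℤ⟦X⟧) ^ p) ^ n)]
  · apply sub_NN p hp L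
    apply Finset.insert_subset _ (img_sub A P N L (by omega) hAP hL)
    rw [Finset.mem_Icc]
    rw [mul_add] at hL
    omega
  · intro h
    obtain ⟨i, _, h⟩ := Finset.mem_image.1 h
    omega

/-- main positivity, generic class. -/
theorem main_NN (p : ℕ) (hp : 1 ≤ p) (A B j N L : ℕ) (hj : 1 ≤ j) (hB : 1 ≤ B) (hA : A = B + j)
    (hL : (A + B) * (N + 1) ≤ L) (α β : ℕ) :
    NN ((poch ((X ^ p) ^ (A + B)) ((X ^ p) ^ (A + B)) N * poch ((X ^ p) ^ A) ((X ^ p) ^ (A + B)) N * 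
          poch ((X ^ p) ^ B) ((X ^ p) ^ (A + B)) N) * 
       ((α : ℤ⟦X⟧) + (β : ℤ⟦X⟧) * ∑ i ∈ Finset.range N, ((X ^ p) ^ (B + (A + B) * i) * geo (p * (B + (A + B) * i)) -
          (X ^ p) ^ (A + (A + B) * i) * geo (p * (A + (A + B) * i)))) * Pi' p L ^ 3) := by
  have hs : ∀ i, ((X ^ p) ^ (B + (A + B) * i) * geo (p * (B + (A + B) * i)) -
          (X ^ p) ^ (A + (A + B) * i) * geo (p * (A + (A + B) * i))) =
      (1 - (X ^ p) ^ j) * (X ^ (p * (B + (A + B) * i)) * geo (p * (B + (A + B) * i)) *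
         geo (p * (A + (A + B) * i))) := by
    intro i
    have h1 := geo_mul' p hp (B + (A + B) * i) (by omega)
    have h2 := geo_mul' p hp (A + (A + B) * i) (by omega)
    have h3 : ((X : ℤ⟦X⟧) ^ p) ^ (A + (A + B) * i) = (X ^ p) ^ (B + (A + B) * i) * (X ^ p) ^ j := by
      rw [← pow_add]; congr 1; omega
    rw [pow_mul]
    rw [h3] at h2 ⊢
    set a := ((X : ℤ⟦X⟧) ^ p) ^ (B + (A + B) * i)
    set b := ((X : ℤ⟦X⟧) ^ p) ^ j
    set u := geo (p * (B + (A + B) * i))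
    set v := geo (p * (A + (A + B) * i))
    linear_combination a * b * v * h1 - a * u * h2
  simp only [hs]
  rw [← Finset.mul_sum]
  set W := ∑ i ∈ Finset.range N, (X ^ (p * (B + (A + B) * i)) * geo (p * (B + (A + B) * i)) *
         geo (p * (A + (A + B) * i))) with hW
  have hWN : NN W := NN.sum _ _ fun i _ => ((NN.X_pow _).mul (geo_NN _)).mul (geo_NN _)
  have hgj := geo_mul' p hp j hj
  have n1 := poch_NN p hp (A + B) (A + B) N L (by omega) le_rfl hL
  have n2 := poch_NN p hp B (A + B) N L (by omega) (by omega) hL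
  by_cases hjA : j < A
  · have n3 := poch_NN' p hp A (A + B) N L j hj hjA (by omega) hL
    have n4 : NN ((α : ℤ⟦X⟧) * geo (p * j) + β * W) := 
      ((NN.nat α).mul (geo_NN _)).add ((NN.nat β).mul hWN)
    have := ((n1.mul n2).mul n3).mul n4
    convert this using 1
    linear_combination (-(poch ((X ^ p) ^ (A + B)) ((X ^ p) ^ (A + B)) N * poch ((X ^ p) ^ A) ((X ^ p) ^ (A + B)) N * 
          poch ((X ^ p) ^ B) ((X ^ p) ^ (A + B)) N) * Pi' p L ^ 3 * α) * hgj
  · omega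

theorem zero_NN (p : ℕ) (hp : 1 ≤ p) (P N L : ℕ) (hP : 1 ≤ P)
    (hL : P * (N + 2) ≤ L) (β : ℕ) :
    NN (((β : ℤ⟦X⟧) * (poch ((X ^ p) ^ P) ((X ^ p) ^ P) (N + 1) * poch ((X ^ p) ^ P) ((X ^ p) ^ P) (N + 1)
      * poch ((X ^ p) ^ P) ((X ^ p) ^ P) N)) * Pi' p L ^ 3) := by
  have n1 := poch_NN p hp P P (N + 1) L hP le_rfl hL
  have n2 := poch_NN p hp P P N L hP le_rfl (le_trans (Nat.mul_le_mul_left _ (by omega)) hL)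
  convert (NN.nat β).mul ((n1.mul n1).mul n2) using 1
  ring

theorem geo_supp (p n k : ℕ) (h : coeff k (geo (p * n)) ≠ 0) : p ∣ k := by
  rw [geo, coeff_mk] at h
  by_contra hh
  exact h (if_neg fun hd => hh ((dvd_mul_right p n).trans hd))

/-- supported on multiples of p -/
def Sup (p : ℕ) (f : ℤ⟦X⟧) : Prop := ∀ k, coeff k f ≠ 0 → p ∣ k

theorem Sup.mul {p : ℕ} {f g : ℤ⟦X⟧} (hf : Sup p f) (hg : Sup p g) : Sup p (f * g) := by
  intro k hk
  rw [coeff_mul] at hk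
  obtain ⟨⟨i, j⟩, hij, h⟩ := Finset.exists_ne_zero_of_sum_ne_zero hk
  rw [Finset.HasAntidiagonal.mem_antidiagonal] at hij
  simp only at hij h
  rw [← hij]
  exact dvd_add (hf _ (left_ne_zero_of_mul h)) (hg _ (right_ne_zero_of_mul h))

theorem Sup.one (p : ℕ) : Sup p 1 := by
  intro k hk
  rw [coeff_one] at hk
  have : k = 0 := by by_contra h; simp [h] at hk
  simp [this]

theorem Pi_sup (p L : ℕ) : Sup p (Pi' p L) := 
  Finset.prod_induction _ (Sup p) (fun _ _ => Sup.mul) (Sup.one p) (fun n _ => geo_supp p n)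

end CubicBorwein
namespace CubicBorwein
open PowerSeries

/-- triangular numbers -/
def tri (k : ℤ) : ℕ := (k * (k + 1) / 2).toNat

theorem tri_spec (k : ℤ) : 2 * (tri k : ℤ) = k * (k + 1) := by
  have h1 : (2 : ℤ) ∣ k * (k + 1) := (Int.even_mul_succ_self k).two_dvd
  have h2 : 0 ≤ k * (k + 1) := by
    rcases le_or_gt 0 k with h | h
    · positivity
    · nlinarith
  unfold tri
  omega

theorem tri_bd (k : ℤ) (n : ℕ) (h : tri k = n) : -(n : ℤ) - 1 ≤ k ∧ k ≤ n := by
  have := tri_spec k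
  rw [h] at this
  constructor
  · by_contra hh
    push Not at hh
    nlinarith
  · by_contra hh
    push Not at hh
    nlinarith

theorem tri_refl (k : ℤ) : tri (-1 - k) = tri k := by
  have h1 := tri_spec k
  have h2 := tri_spec (-1 - k)
  have : (-1 - k) * (-1 - k + 1) = k * (k + 1) := by ring
  omega

theorem choose2_spec (m : ℕ) : 2 * ((m.choose 2 : ℕ) : ℤ) = m * (m - 1) := by
  induction m with
  | zero => simp
  | succ m ih => rw [choose2]; push_cast; linarith

theorem ex_spec (h a : ℕ) (ha : a ≤ h) (m : ℤ) :
    tri a + (2 * h + 1) * ex (h + 1 + a) (h - a) m = tri ((2 * h + 1 : ℕ) * m + a) := by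
  have h1 := tri_spec a
  have h2 := tri_spec ((2 * h + 1 : ℕ) * m + a)
  have h3 : 2 * (ex (h + 1 + a) (h - a) m : ℤ) = (2 * h + 1) * m ^ 2 + (2 * a + 1) * m := by
    have hc := choose2_spec m.natAbs
    unfold ex
    push_cast [Nat.cast_sub ha]
    split_ifs with hm
    · have : |m| = m := abs_of_nonneg hm
      push_cast at hc ⊢
      rw [this] at hc ⊢
      linear_combination (2 * (h : ℤ) + 1) * hc
    · have : |m| = -m := abs_of_neg (by omega)
      push_cast [Nat.cast_sub ha] at hc ⊢
      rw [this] at hc ⊢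
      linear_combination (2 * (h : ℤ) + 1) * hc
  zify
  push_cast at h2 ⊢
  have : 2 * ((tri a : ℤ) + (2 * h + 1) * ex (h + 1 + a) (h - a) m) = 
      2 * (tri ((2 * h + 1) * m + a) : ℤ) := by
    rw [h2]
    linear_combination h1 + (2 * (h : ℤ) + 1) * h3
  linarith

/-- signed weight -/
def fk (k : ℤ) : ℤ := (-1) ^ k.natAbs * (2 * k + 1)

theorem fk_refl (k : ℤ) : fk (-1 - k) = fk k := by
  unfold fk
  have : ((-1 : ℤ)) ^ (-1 - k).natAbs = - (-1) ^ k.natAbs := by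
    rcases Nat.even_or_odd k.natAbs with h | h
    · rw [h.neg_one_pow, Odd.neg_one_pow]; 
      rw [Int.natAbs_even] at h; rw [Int.natAbs_odd]; exact Odd.sub_even (by decide) h
    · rw [h.neg_one_pow, Even.neg_one_pow]; · simp
      rw [Int.natAbs_odd] at h; rw [Int.natAbs_even]; exact Odd.sub_odd (by decide) h
  rw [this]; ring

/-- the finite set of `k` with `tri k = n` -/
noncomputable def Kn (n : ℕ) : Finset ℤ := (Finset.Icc (-(n : ℤ) - 1) n).filter (fun k => tri k = n)

theorem mem_Kn (n : ℕ) (k : ℤ) : k ∈ Kn n ↔ tri k = n := by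
  unfold Kn
  rw [Finset.mem_filter, Finset.mem_Icc]
  exact ⟨fun h => h.2, fun h => ⟨tri_bd k n h, h⟩⟩

/-- The class sum -/
noncomputable def cls (p a n : ℕ) : ℤ := ∑ k ∈ (Kn n).filter (fun k => (p : ℤ) ∣ k - a), fk k

theorem sign_lem (h a : ℕ) (m : ℤ) : 
    (-1 : ℤ) ^ m.natAbs = (-1) ^ a * (-1) ^ (((2 * h + 1 : ℕ) : ℤ) * m + a).natAbs := by
  rw [← pow_add]
  rcases Int.even_or_odd m with hm | hm
  · rw [(Int.natAbs_even.2 hm).neg_one_pow, Even.neg_one_pow]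
    rcases Nat.even_or_odd a with ha | ha
    · apply ha.add
      rw [Int.natAbs_even]
      exact (hm.mul_left _).add (by exact_mod_cast ha)
    · apply ha.add_odd
      rw [Int.natAbs_odd]
      exact (hm.mul_left _).add_odd (by exact_mod_cast ha)
  · rw [(Int.natAbs_odd.2 hm).neg_one_pow, Odd.neg_one_pow]
    have ho : Odd (((2 * h + 1 : ℕ) : ℤ) * m) := Odd.mul (by push_cast; exact ⟨h, rfl⟩) hm
    rcases Nat.even_or_odd a with ha | ha
    · apply ha.add_odd
      rw [Int.natAbs_odd]
      exact ho.add_even (by exact_mod_cast ha)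
    · apply ha.add_even
      rw [Int.natAbs_even]
      exact ho.add_odd (by exact_mod_cast ha)

theorem V_eq (h a N n : ℕ) (ha : a ≤ h) (hn : n < N) :
    ∑ k ∈ Finset.range (2 * N + 1), (if tri ((2 * h + 1 : ℕ) * ((k : ℤ) - N) + a) = n then
      (-1 : ℤ) ^ ((k : ℤ) - N).natAbs * (2 * ((2 * h + 1 : ℕ) * ((k : ℤ) - N) + a) + 1) else 0) 
      = (-1) ^ a * cls (2 * h + 1) a n := by
  rw [← Finset.sum_filter, cls, Finset.mul_sum]
  refine Finset.sum_bij (fun k _ => ((2 * h + 1 : ℕ) : ℤ) * ((k : ℤ) - N) + a) ?_ ?_ ?_ ?_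
  · intro k hk
    rw [Finset.mem_filter] at hk
    rw [Finset.mem_filter, mem_Kn]
    exact ⟨hk.2, ⟨(k : ℤ) - N, by ring⟩⟩
  · intro k _ l _ hkl
    have h1 : ((2 * h + 1 : ℕ) : ℤ) * ((k : ℤ) - N) = ((2 * h + 1 : ℕ) : ℤ) * ((l : ℤ) - N) := by
      linarith
    have := mul_left_cancel₀ (by positivity) h1
    omega
  · intro k hk
    rw [Finset.mem_filter, mem_Kn] at hk
    obtain ⟨m, hm⟩ := hk.2
    have hb := tri_bd k n hk.1
    have hk' : k = ((2 * h + 1 : ℕ) : ℤ) * m + a := by linarith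
    have hm1 : m ≤ N := by
      by_contra hh; push Not at hh
      push_cast at hk'
      nlinarith
    have hm2 : -N ≤ m := by
      by_contra hh; push Not at hh
      push_cast at hk'
      nlinarith
    refine ⟨(m + N).toNat, ?_, ?_⟩
    · rw [Finset.mem_filter, Finset.mem_range]
      refine ⟨by omega, ?_⟩
      have : (((m + N).toNat : ℕ) : ℤ) - N = m := by omega
      rw [this, ← hk']; exact hk.1
    · have : (((m + N).toNat : ℕ) : ℤ) - N = m := by omega
      rw [this, ← hk']
  · intro k hk
    rw [sign_lem h a, fk]; ring

theorem theta_coeff (h a N n : ℕ) (ha : a ≤ h) (hn : n < N) (E : ℤ⟦X⟧) 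
    (hE : ((X : ℤ⟦X⟧) ^ (2 * h + 1)) ^ ((h + 1 + a + (h - a)) * N) ∣ E - 
     ∑ k ∈ Finset.range (2 * N + 1), (-1) ^ ((k : ℤ) - N).natAbs * 
        (((2 * a + 1 : ℕ) : ℤ⟦X⟧) + ((2 * (2 * h + 1) : ℕ) : ℤ⟦X⟧) * (((k : ℤ) - N : ℤ) : ℤ⟦X⟧)) * 
          ((X : ℤ⟦X⟧) ^ (2 * h + 1)) ^ (ex (h + 1 + a) (h - a) ((k : ℤ) - N))) :
    coeff n (X ^ (tri a) * E) = (-1) ^ a * cls (2 * h + 1) a n := by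
  have hE2 : (X : ℤ⟦X⟧) ^ N ∣ X ^ tri a * E - ∑ k ∈ Finset.range (2 * N + 1), 
      X ^ tri a * ((-1) ^ ((k : ℤ) - N).natAbs * 
        (((2 * a + 1 : ℕ) : ℤ⟦X⟧) + ((2 * (2 * h + 1) : ℕ) : ℤ⟦X⟧) * (((k : ℤ) - N : ℤ) : ℤ⟦X⟧)) * 
          ((X : ℤ⟦X⟧) ^ (2 * h + 1)) ^ (ex (h + 1 + a) (h - a) ((k : ℤ) - N))) := by
    rw [← Finset.mul_sum, ← mul_sub]
    refine Dvd.dvd.mul_left ?_ _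
    rw [← pow_mul] at hE
    refine (pow_dvd_pow _ ?_).trans hE
    calc N = 1 * (1 * N) := by ring
      _ ≤ _ := Nat.mul_le_mul (by omega) (Nat.mul_le_mul (by omega) le_rfl)
  rw [X_pow_dvd_iff] at hE2
  have := hE2 n hn
  rw [map_sub, sub_eq_zero] at this
  rw [this, ← V_eq h a N n ha hn, map_sum]
  apply Finset.sum_congr rfl
  intro k _
  set m : ℤ := (k : ℤ) - N
  have h1 : X ^ tri a * ((-1) ^ m.natAbs * 
        (((2 * a + 1 : ℕ) : ℤ⟦X⟧) + ((2 * (2 * h + 1) : ℕ) : ℤ⟦X⟧) * ((m : ℤ) : ℤ⟦X⟧)) * 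
          ((X : ℤ⟦X⟧) ^ (2 * h + 1)) ^ (ex (h + 1 + a) (h - a) m)) = 
      C ((-1 : ℤ) ^ m.natAbs * (2 * ((2 * h + 1 : ℕ) * m + a) + 1)) * 
        X ^ (tri ((2 * h + 1 : ℕ) * m + a)) := by
    rw [← ex_spec h a ha, pow_add, pow_mul]
    simp only [map_mul, map_add, map_pow, map_neg, map_one, map_natCast, map_ofNat]
    push_cast
    have : (C : ℤ →+* ℤ⟦X⟧) m = (m : ℤ⟦X⟧) := by simp
    rw [this]
    ring
  rw [h1, coeff_C_mul, coeff_X_pow]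
  simp only [eq_comm, mul_ite, mul_one, mul_zero]

theorem cls_one (n : ℕ) : cls 1 0 n = ∑ k ∈ Kn n, fk k := by
  unfold cls
  congr 1
  apply Finset.filter_true_of_mem
  intro k _
  simp

/-- If `n` is in the class of `tri a`. -/
theorem cls_rel (h a : ℕ) (ha : a ≤ h) (hp : (2 * h + 1).Prime) : ∃ w : ℤ, 0 < w ∧ ∀ n : ℕ,
    ((2 * h + 1 : ℕ) : ℤ) ∣ (n : ℤ) - tri a → cls 1 0 n = w * cls (2 * h + 1) a n := by
  have key : ∀ n : ℕ, ((2 * h + 1 : ℕ) : ℤ) ∣ (n : ℤ) - tri a → ∀ k ∈ Kn n, 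
      ((2 * h + 1 : ℕ) : ℤ) ∣ k - a ∨ ((2 * h + 1 : ℕ) : ℤ) ∣ (-1 - k) - a := by
    intro n hn k hk
    rw [mem_Kn] at hk
    have h1 := tri_spec k
    have h2 := tri_spec a
    rw [hk] at h1
    have : ((2 * h + 1 : ℕ) : ℤ) ∣ (k - a) * ((-1 - k) - a) := by
      have e : (k - a) * ((-1 - k) - a) = ((n : ℤ) - tri a) * (-2) := by linear_combination h1 - h2
      rw [e]; exact hn.mul_right _
    exact (Nat.prime_iff_prime_int.1 hp).dvd_or_dvd this
  rcases eq_or_lt_of_le ha with hah | hah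
  · refine ⟨1, one_pos, fun n hn => ?_⟩
    rw [one_mul, cls_one, cls]
    congr 1
    symm
    apply Finset.filter_true_of_mem
    intro k hk
    rcases key n hn k hk with hd | hd
    · exact hd
    · have e : k - a = -((-1 - k) - a) - ((2 * h + 1 : ℕ) : ℤ) := by
        rw [hah]; push_cast; ring
      rw [e]
      exact dvd_sub (dvd_neg.2 hd) dvd_rfl
  · refine ⟨2, two_pos, fun n hn => ?_⟩
    have hsplit := Finset.sum_filter_add_sum_filter_not (Kn n) 
      (fun k => ((2 * h + 1 : ℕ) : ℤ) ∣ k - a) fk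
    rw [cls_one, ← hsplit, two_mul (cls _ _ _), cls]
    refine congrArg₂ (fun u v : ℤ => u + v) rfl ?_
    refine Finset.sum_bij' (fun k _ => -1 - k) (fun k _ => -1 - k) ?_ ?_ ?_ ?_ ?_
    · intro k hk
      rw [Finset.mem_filter] at hk ⊢
      refine ⟨?_, (key n hn k hk.1).resolve_left hk.2⟩
      rw [mem_Kn, tri_refl, ← mem_Kn]; exact hk.1
    · intro k hk
      rw [Finset.mem_filter] at hk ⊢
      refine ⟨?_, ?_⟩
      · rw [mem_Kn, tri_refl, ← mem_Kn]; exact hk.1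
      · intro hd
        have := dvd_add hk.2 hd
        have e : k - a + (-1 - k - a) = -((2 * a + 1 : ℕ) : ℤ) := by push_cast; ring
        rw [e, dvd_neg] at this
        have := Nat.le_of_dvd (by omega) (Int.natCast_dvd_natCast.1 this)
        omega
    · intro k _; ring
    · intro k _; ring
    · intro k _; rw [fk_refl]

theorem exists_rep (h : ℕ) (k : ℤ) : ∃ a : ℕ, a ≤ h ∧ 
    ((2 * h + 1 : ℕ) : ℤ) ∣ (tri k : ℤ) - tri a := by
  set p : ℤ := ((2 * h + 1 : ℕ) : ℤ) with hp
  have hodd : IsCoprime p 2 := ⟨1, -h, by rw [hp]; push_cast; ring⟩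
  have aux : ∀ a : ℤ, p ∣ k - a ∨ p ∣ k + 1 + a → p ∣ (tri k : ℤ) - tri a := by
    intro a ha
    apply hodd.dvd_of_dvd_mul_left
    have e : 2 * ((tri k : ℤ) - tri a) = (k - a) * (k + 1 + a) := by
      linear_combination tri_spec k - tri_spec a
    rw [e]
    rcases ha with ha | ha
    · exact ha.mul_right _
    · exact ha.mul_left _
  have hp0 : 0 < p := by omega
  have h1 := Int.emod_nonneg k hp0.ne'
  have h2 := Int.emod_lt_of_pos k hp0
  have h3 := Int.emod_add_mul_ediv k p
  by_cases hc : k % p ≤ h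
  · refine ⟨(k % p).toNat, by omega, ?_⟩
    have e : (((k % p).toNat : ℕ) : ℤ) = k % p := by omega
    rw [e]
    exact aux _ (Or.inl ⟨k / p, by linarith⟩)
  · refine ⟨(p - 1 - k % p).toNat, by omega, ?_⟩
    have e : (((p - 1 - k % p).toNat : ℕ) : ℤ) = p - 1 - k % p := by omega
    rw [e]
    exact aux _ (Or.inr ⟨k / p + 1, by linarith⟩)

end CubicBorwein
namespace CubicBorwein
open PowerSeries

theorem jac (N n : ℕ) (hn : n < N + 1) : 
    2 * coeff n (poch (X : ℤ⟦X⟧) X (N + 1) * poch X X (N + 1) * poch X X N) = cls 1 0 n := by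
  have h0 := theta_zero (X : ℤ⟦X⟧) 1 N (1 : ℤ⟦X⟧) 2
  have := theta_coeff 0 0 (N + 1) n le_rfl hn _ (by simpa using h0)
  have e : tri ((0 : ℕ) : ℤ) = 0 := by simp [tri]
  rw [e] at this
  simp only [pow_zero, one_mul] at this
  have e2 : (2 : ℤ⟦X⟧) = C (2 : ℤ) := (map_ofNat _ 2).symm
  rw [e2, coeff_C_mul] at this
  simpa using this

theorem class_pos (h a N : ℕ) (ha : a ≤ h) : ∃ E : ℤ⟦X⟧,
    (∀ n < N, coeff n (X ^ tri a * E) = (-1) ^ a * cls (2 * h + 1) a n) ∧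
    ∀ L, (2 * h + 1) * (N + 2) ≤ L → NN (E * Pi' (2 * h + 1) L ^ 3) := by
  rcases eq_or_lt_of_le ha with hah | hah
  · subst hah
    refine ⟨_, fun n hn => theta_coeff a a (N + 1) n le_rfl (by omega) 
      (((2 * (2 * a + 1) : ℕ) : ℤ⟦X⟧) * 
       (poch ((X ^ (2 * a + 1)) ^ (2 * a + 1)) ((X ^ (2 * a + 1)) ^ (2 * a + 1)) (N + 1) *
        poch ((X ^ (2 * a + 1)) ^ (2 * a + 1)) ((X ^ (2 * a + 1)) ^ (2 * a + 1)) (N + 1) *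
        poch ((X ^ (2 * a + 1)) ^ (2 * a + 1)) ((X ^ (2 * a + 1)) ^ (2 * a + 1)) N)) ?_, ?_⟩
    · have e : a + 1 + a = 2 * a + 1 := by ring
      rw [Nat.sub_self, e, add_zero]
      exact theta_zero _ _ _ _ _
    · intro L hL
      exact zero_NN _ (by omega) _ _ _ (by omega) hL _
  · have hP : h + 1 + a + (h - a) = 2 * h + 1 := by omega
    refine ⟨_, fun n hn => theta_coeff h a N n ha hn _ 
      (theta_pos _ (fun n => geo ((2 * h + 1) * n)) (fun n hn => geo_mul' _ (by omega) n hn) 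
        _ _ _ (by omega) (by omega) _ _), ?_⟩
    intro L hL
    refine main_NN (2 * h + 1) (by omega) (h + 1 + a) (h - a) (2 * a + 1) N L (by omega) (by omega)
      (by omega) ?_ _ _
    rw [hP]
    refine le_trans (Nat.mul_le_mul_left _ (by omega)) hL

theorem coeff_mul_congr (p n : ℕ) (f g D : ℤ⟦X⟧) (hD : Sup p D) 
    (H : ∀ i ≤ n, (p : ℤ) ∣ (i : ℤ) - n → coeff i f = coeff i g) : 
    coeff n (f * D) = coeff n (g * D) := by
  rw [coeff_mul, coeff_mul]
  apply Finset.sum_congr rfl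
  rintro ⟨i, l⟩ hil
  rw [Finset.HasAntidiagonal.mem_antidiagonal] at hil
  simp only at hil ⊢
  by_cases h0 : coeff l D = 0
  · rw [h0]; simp
  · have hd := hD l h0
    rw [H i (by omega)]
    have : (i : ℤ) - n = -(l : ℤ) := by omega
    rw [this, dvd_neg]
    exact_mod_cast hd

theorem main_sign (h N L : ℕ) (hp : (2 * h + 1).Prime) (hL : (2 * h + 1) * (N + 2) ≤ L) 
    (J : ℤ⟦X⟧) (hJ : ∀ n < N, 2 * coeff n J = cls 1 0 n) (n : ℕ) (hn : n + (2 * h + 1) < N) :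
    0 ≤ coeff n (J * Pi' (2 * h + 1) L ^ 3) * 
      coeff (n + (2 * h + 1)) (J * Pi' (2 * h + 1) L ^ 3) := by
  set p := 2 * h + 1 with hpdef
  set D := Pi' p L ^ 3 with hD
  have hDs : Sup p D := by
    rw [hD, pow_succ, pow_two]
    exact ((Pi_sup p L).mul (Pi_sup p L)).mul (Pi_sup p L)
  have two : ∀ (f : ℤ⟦X⟧) n (z : ℤ), coeff n (C z * f * D) = z * coeff n (f * D) := by
    intro f n z
    rw [mul_assoc, coeff_C_mul]
  by_cases hex : ∃ k : ℤ, (p : ℤ) ∣ (n : ℤ) - tri k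
  · obtain ⟨k, hk⟩ := hex
    obtain ⟨a, ha, hka⟩ := exists_rep h k
    obtain ⟨w, hw, hrel⟩ := cls_rel h a ha hp
    obtain ⟨E, hE1, hE2⟩ := class_pos h a N ha
    have hpos : NN (X ^ tri a * E * D) := by
      rw [mul_assoc]
      exact (NN.X_pow _).mul (hE2 L hL)
    have key : ∀ i < N, (p : ℤ) ∣ (i : ℤ) - n → 
        2 * coeff i (J * D) = w * (-1) ^ a * coeff i (X ^ tri a * E * D) := by
      intro i hi hin
      rw [← two, ← two]
      apply coeff_mul_congr p i _ _ D hDs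
      intro j hj hji
      rw [coeff_C_mul, coeff_C_mul, hJ j (by omega), hE1 j (by omega), hrel j]
      · have : ((-1 : ℤ) ^ a) * (-1) ^ a = 1 := by rw [← mul_pow]; simp
        linear_combination (-(w * cls (2 * h + 1) a j)) * this
      · have e : (j : ℤ) - tri a = (j - i) + (i - n) + (n - tri k) + (tri k - tri a) := by ring
        rw [e]
        exact dvd_add (dvd_add (dvd_add hji hin) hk) hka
    have k1 := key n (by omega) (by simp)
    have k2 := key (n + p) (by omega) (by simp)
    have : 0 ≤ (2 * coeff n (J * D)) * (2 * coeff (n + p) (J * D)) := by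
      rw [k1, k2]
      have e : ((-1 : ℤ) ^ a) * (-1) ^ a = 1 := by rw [← mul_pow]; simp
      have e2 : w * (-1) ^ a * coeff n (X ^ tri a * E * D) * 
         (w * (-1) ^ a * coeff (n + p) (X ^ tri a * E * D)) = 
         ((-1 : ℤ) ^ a * (-1) ^ a) * (w * w * (coeff n (X ^ tri a * E * D) * 
          coeff (n + p) (X ^ tri a * E * D))) := by ring
      rw [e2, e, one_mul]
      exact mul_nonneg (by positivity) (mul_nonneg (hpos _) (hpos _))
    linarith
  · push Not at hex
    have : coeff n (C 2 * J * D) = coeff n (0 * D) := by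
      apply coeff_mul_congr p n _ _ D hDs
      intro i hi hin
      rw [coeff_C_mul, hJ i (by omega), cls_one]
      have : Kn i = ∅ := by
        rw [Finset.eq_empty_iff_forall_notMem]
        intro k hk
        rw [mem_Kn] at hk
        apply hex k
        rw [hk, ← neg_sub, dvd_neg]; exact hin
      rw [this]; simp
    rw [two] at this
    simp only [zero_mul, map_zero] at this
    have : coeff n (J * D) = 0 := by omega
    rw [this]; simp

/-- partial Borwein product -/
noncomputable def Gp (p M : ℕ) : ℤ⟦X⟧ := 
  ∏ i ∈ Finset.range M, (if p ∣ i + 1 then 1 else 1 - X ^ (i + 1))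

theorem full_prod (p : ℕ) (hp : 1 ≤ p) (L : ℕ) : 
    poch (X : ℤ⟦X⟧) X (p * L) = Gp p (p * L) * ∏ n ∈ Finset.Icc 1 L, (1 - (X ^ p) ^ n) := by
  induction L with
  | zero => simp [poch, Gp]
  | succ L ih =>
    rw [Finset.prod_Icc_succ_top (by omega), mul_add, mul_one]
    have h1 : poch (X : ℤ⟦X⟧) X (p * L + p) = poch (X : ℤ⟦X⟧) X (p * L) * 
      ∏ i ∈ Finset.range p, (1 - X ^ (p * L + i + 1)) := by
      unfold poch
      rw [Finset.prod_range_add]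
      simp only [← pow_succ']
    have h2 : Gp p (p * L + p) = Gp p (p * L) * 
      ∏ i ∈ Finset.range p, (if p ∣ p * L + i + 1 then 1 else 1 - X ^ (p * L + i + 1)) := by
      unfold Gp
      rw [Finset.prod_range_add]
    rw [h1, h2, ih]
    have h3 : (1 - ((X : ℤ⟦X⟧) ^ p) ^ (L + 1)) = 
       ∏ i ∈ Finset.range p, (if p ∣ p * L + i + 1 then 1 - X ^ (p * L + i + 1) else 1) := by
      rw [Finset.prod_eq_single (p - 1)]
      · have : p * L + (p - 1) + 1 = p * (L + 1) := by rw [mul_add]; omega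
        rw [this, if_pos (dvd_mul_right _ _), pow_mul]
      · intro i hi hne
        rw [Finset.mem_range] at hi
        rw [if_neg]
        rw [add_assoc, Nat.dvd_add_right (dvd_mul_right _ _)]
        intro hd
        have := Nat.le_of_dvd (by omega) hd
        omega
      · intro hh; exact absurd (Finset.mem_range.2 (by omega)) hh
    have h4 : ∏ i ∈ Finset.range p, (1 - (X : ℤ⟦X⟧) ^ (p * L + i + 1)) = 
      (∏ i ∈ Finset.range p, (if p ∣ p * L + i + 1 then 1 else 1 - X ^ (p * L + i + 1))) *
      ∏ i ∈ Finset.range p, (if p ∣ p * L + i + 1 then 1 - X ^ (p * L + i + 1) else 1) := by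
      rw [← Finset.prod_mul_distrib]
      apply Finset.prod_congr rfl
      intro i _
      split_ifs <;> simp
    rw [h3, h4]; ring

theorem Gp_eq (p : ℕ) (hp : 1 ≤ p) (L : ℕ) : 
    Gp p (p * L) = poch (X : ℤ⟦X⟧) X (p * L) * Pi' p L := by
  rw [full_prod p hp, Pi', mul_assoc, ← Finset.prod_mul_distrib, Finset.prod_eq_one, mul_one]
  intro n hn
  rw [mul_comm, geo_mul' p hp n (Finset.mem_Icc.1 hn).1]

theorem poch_coeff (N M n : ℕ) (hNM : N ≤ M) (hn : n < N + 1) : 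
    2 * coeff n (poch (X : ℤ⟦X⟧) X M ^ 3) = cls 1 0 n := by
  rw [← jac N n hn]
  congr 1
  obtain ⟨v, hv, hd⟩ := poch_self_split (X : ℤ⟦X⟧) N (M - N)
  obtain ⟨v', hv', hd'⟩ := poch_self_split (X : ℤ⟦X⟧) N 1
  rw [Nat.add_sub_cancel' hNM] at hv
  have : (X : ℤ⟦X⟧) ^ (N + 1) ∣ poch X X M ^ 3 - poch X X (N + 1) * poch X X (N + 1) * poch X X N := by
    rw [hv, hv']
    have e : (poch (X : ℤ⟦X⟧) X N * v) ^ 3 - poch X X N * v' * (poch X X N * v') * poch X X N =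
      (v - 1) * (poch X X N ^ 3 * (v ^ 2 + v + 1)) - (v' - 1) * (poch X X N ^ 3 * (v' + 1)) := by ring
    rw [e]
    exact dvd_sub (hd.mul_right _) (hd'.mul_right _)
  rw [X_pow_dvd_iff] at this
  have := this n hn
  rwa [map_sub, sub_eq_zero] at this

theorem odd_case (h : ℕ) (hp : (2 * h + 1).Prime) (n : ℕ) : ∃ M₀, ∀ L, M₀ ≤ L → 
    0 ≤ coeff n (Gp (2 * h + 1) ((2 * h + 1) * L) ^ 3) * 
      coeff (n + (2 * h + 1)) (Gp (2 * h + 1) ((2 * h + 1) * L) ^ 3) := by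
  set N := n + (2 * h + 1) + 1 with hN
  refine ⟨(2 * h + 1) * (N + 2), fun L hL => ?_⟩
  rw [Gp_eq _ (by omega), mul_pow]
  have hNL : N ≤ (2 * h + 1) * L := by nlinarith
  exact main_sign h N L hp hL _ (fun n hn => poch_coeff N _ n hNL (by omega)) n (by omega)

/-- alternating signs -/
def Alt (f : ℤ⟦X⟧) : Prop := ∀ n, 0 ≤ (-1) ^ n * coeff n f

theorem Alt.mul {f g : ℤ⟦X⟧} (hf : Alt f) (hg : Alt g) : Alt (f * g) := by
  intro n
  rw [coeff_mul, Finset.mul_sum]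
  apply Finset.sum_nonneg
  rintro ⟨i, j⟩ hij
  rw [Finset.HasAntidiagonal.mem_antidiagonal] at hij
  simp only at hij ⊢
  have := mul_nonneg (hf i) (hg j)
  rw [← hij, pow_add]
  linarith

theorem Alt.one : Alt 1 := by
  intro n
  rw [coeff_one]
  split_ifs with h
  · simp [h]
  · simp

theorem Gp_two (M : ℕ) : Alt (Gp 2 M) := by
  refine Finset.prod_induction _ Alt (fun _ _ => Alt.mul) Alt.one ?_
  intro i _
  split_ifs with h
  · exact Alt.one
  · intro n
    rw [map_sub, coeff_X_pow, coeff_one]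
    by_cases h1 : n = i + 1
    · have : Odd n := by rw [h1, Nat.odd_iff]; omega
      simp [h1 ▸ this.neg_one_pow, h1]
    · simp only [h1, if_false, sub_zero]
      split_ifs with h2
      · simp [h2]
      · simp

theorem two_case (n M : ℕ) : 0 ≤ coeff n (Gp 2 M ^ 3) * coeff (n + 2) (Gp 2 M ^ 3) := by
  have h : Alt (Gp 2 M ^ 3) := by
    rw [pow_succ, pow_two]
    exact ((Gp_two M).mul (Gp_two M)).mul (Gp_two M)
  have := mul_nonneg (h n) (h (n + 2))
  have e : ((-1 : ℤ) ^ n) * (-1) ^ n = 1 := by rw [← mul_pow]; simp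
  have e2 : (-1 : ℤ) ^ n * coeff n (Gp 2 M ^ 3) * ((-1) ^ (n + 2) * coeff (n + 2) (Gp 2 M ^ 3)) =
    ((-1) ^ n * (-1) ^ n) * (coeff n (Gp 2 M ^ 3) * coeff (n + 2) (Gp 2 M ^ 3)) := by ring
  rwa [e2, e, one_mul] at this

theorem formal_case (p : ℕ) (hp : p.Prime) (n : ℕ) : ∃ M₀, ∀ L, M₀ ≤ L → 
    0 ≤ coeff n (Gp p (p * L) ^ 3) * coeff (n + p) (Gp p (p * L) ^ 3) := by
  rcases hp.eq_two_or_odd' with rfl | ho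
  · exact ⟨0, fun L _ => two_case n _⟩
  · obtain ⟨h, rfl⟩ := ho
    exact odd_case h hp n
end CubicBorwein
namespace CubicBorwein
open PowerSeries Filter Topology

theorem coeff_vanish (d : ℕ → ℂ) (h : ℂ → ℂ)
    (hs : ∀ q : ℂ, ‖q‖ < 1 → HasSum (fun n : ℕ => d n * q ^ n) (h q)) (K : ℝ) (M : ℕ)
    (hb : ∀ q : ℂ, ‖q‖ ≤ 1 / 2 → ‖h q‖ ≤ K * ‖q‖ ^ (M + 1)) : ∀ n ≤ M, d n = 0 := by
  have hF : HasFPowerSeriesOnBall h (.ofScalars ℂ d) 0 1 := by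
    constructor
    · refine le_of_forall_lt_imp_le_of_dense fun r hr ↦ ?_
      lift r to NNReal using hr.ne_top
      apply FormalMultilinearSeries.le_radius_of_summable
      simpa [smul_eq_mul, norm_mul, mul_comm, mul_left_comm, mul_assoc] using
        (hs (r : ℂ) (by simpa using hr)).summable.norm
    · simp
    · intro y hy
      rw [← ENNReal.coe_one, Metric.eball_coe, NNReal.coe_one, mem_ball_zero_iff] at hy
      simpa [mul_comm] using hs y hy
  intro n
  induction n using Nat.strong_induction_on with
  | _ n ih =>
    intro hn
    have h1 := hF.hasFPowerSeriesAt.isBigO_sub_partialSum_pow (n + 1)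
    have h2 : h =O[𝓝 0] fun y : ℂ => ‖y‖ ^ (n + 1) := by
      refine Asymptotics.IsBigO.of_bound |K| ?_
      filter_upwards [Metric.closedBall_mem_nhds (0 : ℂ) (by norm_num : (0:ℝ) < 1 / 2)] with y hy
      have hy' : ‖y‖ ≤ 1 / 2 := by simpa using hy
      refine (hb y hy').trans ?_
      rw [Real.norm_of_nonneg (by positivity)]
      have : ‖y‖ ^ (M + 1) ≤ ‖y‖ ^ (n + 1) :=
        pow_le_pow_of_le_one (norm_nonneg _) (by linarith) (by omega)
      calc K * ‖y‖ ^ (M + 1) ≤ |K| * ‖y‖ ^ (M + 1) := by gcongr; exact le_abs_self K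
        _ ≤ _ := by gcongr
    have h3 := h2.sub (by simpa using h1)
    have h4 := Asymptotics.IsBigO.continuousMultilinearMap_apply_eq_zero
      (p := FormalMultilinearSeries.ofScalars ℂ d n) (h3.congr_left fun y => ?_) 1
    · simpa using h4
    · rw [FormalMultilinearSeries.partialSum, Finset.sum_range_succ, Finset.sum_eq_zero]
      · simp
      · intro k hk
        have hk := Finset.mem_range.1 hk
        simp [ih k hk (by omega)]

noncomputable def GpP (p M : ℕ) : Polynomial ℤ :=
  ∏ i ∈ Finset.range M, (if p ∣ i + 1 then 1 else 1 - Polynomial.X ^ (i + 1))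

theorem GpP_coe (p M : ℕ) : ((GpP p M : Polynomial ℤ) : ℤ⟦X⟧) = Gp p M := by
  unfold GpP Gp
  rw [← Polynomial.coeToPowerSeries.ringHom_apply, map_prod]
  refine Finset.prod_congr rfl fun i _ => ?_
  split_ifs <;> simp

theorem poly_hasSum (P : Polynomial ℤ) (q : ℂ) :
    HasSum (fun n : ℕ => (P.coeff n : ℂ) * q ^ n) (P.eval₂ (Int.castRingHom ℂ) q) := by
  rw [Polynomial.eval₂_eq_sum_range]
  refine hasSum_sum_of_ne_finset_zero fun n hn => ?_
  rw [Polynomial.coeff_eq_zero_of_natDegree_lt (by simpa using hn)]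
  simp

theorem prod_bound (p : ℕ) (q : ℂ) (hq : ‖q‖ ≤ 1 / 2) (M : ℕ) :
    ‖(∏' n : ℕ, if p ∣ (n + 1) then 1 else (1 - q ^ (n + 1))) ^ 3 -
      (∏ n ∈ Finset.range M, if p ∣ (n + 1) then 1 else (1 - q ^ (n + 1))) ^ 3‖ ≤
      6 * Real.exp 1 ^ 4 * ‖q‖ ^ (M + 1) := by
  set f : ℕ → ℂ := fun n => if p ∣ (n + 1) then 0 else - q ^ (n + 1) with hf
  have e : ∀ n : ℕ, (if p ∣ (n + 1) then 1 else (1 - q ^ (n + 1))) = 1 + f n := by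
    intro n; simp only [hf]; split_ifs <;> ring
  simp_rw [e]
  have hfn : ∀ n, ‖f n‖ ≤ ‖q‖ ^ (n + 1) := by
    intro n; simp only [hf]; split_ifs <;> simp
  have hsum : Summable fun n => ‖q‖ ^ (n + 1) := by
    simp_rw [pow_succ]
    exact (summable_geometric_of_lt_one (norm_nonneg _) (by linarith)).mul_right _
  have hfs : Summable fun n => ‖f n‖ := hsum.of_nonneg_of_le (fun _ => norm_nonneg _) hfn
  have hmul : Multipliable fun n => 1 + f n := multipliable_one_add_of_summable hfs
  have hgeo : ∀ A B, A ≤ B → ∑ i ∈ Finset.Ico A B, ‖f i‖ ≤ 2 * ‖q‖ ^ (A + 1) := by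
    intro A B hAB
    have : ∑ i ∈ Finset.Ico A B, ‖f i‖ ≤ 2 * ‖q‖ ^ (A + 1) - 2 * ‖q‖ ^ (B + 1) := by
      induction B, hAB using Nat.le_induction with
      | base => simp
      | succ B hB ih =>
        rw [Finset.sum_Ico_succ_top hB]
        have h1 := hfn B
        have h2 : ‖q‖ ^ (B + 1 + 1) ≤ ‖q‖ ^ (B + 1) * (1 / 2) := by
          rw [pow_succ]; gcongr
        linarith
    have : 0 ≤ ‖q‖ ^ (B + 1) := by positivity
    linarith
  have hnorm : ∀ N, ‖∏ i ∈ Finset.range N, (1 + f i)‖ ≤ Real.exp 1 := by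
    intro N
    have h1 := hgeo 0 N (Nat.zero_le _)
    rw [norm_prod]
    calc _ ≤ ∏ i ∈ Finset.range N, Real.exp ‖f i‖ := by
          refine Finset.prod_le_prod (fun _ _ => norm_nonneg _) fun i _ => ?_
          have := norm_add_le 1 (f i)
          have h3 := Real.add_one_le_exp ‖f i‖
          rw [norm_one] at this
          linarith
      _ = Real.exp (∑ i ∈ Finset.range N, ‖f i‖) := (Real.exp_sum _ _).symm
      _ ≤ _ := by
        apply Real.exp_le_exp.2
        rw [Finset.range_eq_Ico]
        simp at h1 ⊢
        linarith
  have hdiff : ∀ N, M ≤ N → ‖∏ i ∈ Finset.range N, (1 + f i) - ∏ i ∈ Finset.range M, (1 + f i)‖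
      ≤ 2 * Real.exp 1 ^ 2 * ‖q‖ ^ (M + 1) := by
    intro N hN
    rw [← Finset.prod_range_mul_prod_Ico _ hN]
    have h1 := Finset.norm_prod_one_add_sub_one_le (Finset.Ico M N) f
    have h2 := hgeo M N hN
    set s := ∑ i ∈ Finset.Ico M N, ‖f i‖
    have hs0 : 0 ≤ s := Finset.sum_nonneg fun _ _ => norm_nonneg _
    have hs1 : s ≤ 1 := by
      have : ‖q‖ ^ (M + 1) ≤ ‖q‖ ^ 1 :=
        pow_le_pow_of_le_one (norm_nonneg _) (by linarith) (by omega)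
      rw [pow_one] at this
      linarith
    have h3 : Real.exp s - 1 ≤ s * Real.exp 1 := by
      have a1 := Real.add_one_le_exp (-s)
      have a2 : Real.exp (-s) * Real.exp s = 1 := by rw [← Real.exp_add]; simp
      have a3 : Real.exp s ≤ Real.exp 1 := Real.exp_le_exp.2 hs1
      have a4 := Real.exp_pos s
      nlinarith
    have h4 : ‖∏ i ∈ Finset.Ico M N, (1 + f i) - 1‖ ≤ 2 * ‖q‖ ^ (M + 1) * Real.exp 1 := by
      refine h1.trans (h3.trans ?_)
      gcongr
    calc _ = ‖∏ i ∈ Finset.range M, (1 + f i)‖ * ‖∏ i ∈ Finset.Ico M N, (1 + f i) - 1‖ := by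
          rw [← norm_mul]; congr 1; ring
      _ ≤ Real.exp 1 * (2 * ‖q‖ ^ (M + 1) * Real.exp 1) := by
          gcongr
          exact hnorm M
      _ = _ := by ring
  have hlim := hmul.hasProd.tendsto_prod_nat
  have hlim' := ((hlim.pow 3).sub_const ((∏ i ∈ Finset.range M, (1 + f i)) ^ 3)).norm
  refine le_of_tendsto hlim' ?_
  filter_upwards [eventually_ge_atTop M] with N hN
  have k1 := hnorm N
  have k2 := hnorm M
  have k3 := hdiff N hN
  set a := ∏ i ∈ Finset.range N, (1 + f i)
  set b := ∏ i ∈ Finset.range M, (1 + f i)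
  have k4 : ‖a ^ 2 + a * b + b ^ 2‖ ≤ 3 * Real.exp 1 ^ 2 := by
    calc _ ≤ ‖a ^ 2‖ + ‖a * b‖ + ‖b ^ 2‖ := norm_add₃_le
      _ = ‖a‖ ^ 2 + ‖a‖ * ‖b‖ + ‖b‖ ^ 2 := by simp
      _ ≤ Real.exp 1 ^ 2 + Real.exp 1 * Real.exp 1 + Real.exp 1 ^ 2 := by gcongr
      _ = _ := by ring
  calc ‖a ^ 3 - b ^ 3‖ = ‖a - b‖ * ‖a ^ 2 + a * b + b ^ 2‖ := by
        rw [← norm_mul]; congr 1; ring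
    _ ≤ (2 * Real.exp 1 ^ 2 * ‖q‖ ^ (M + 1)) * (3 * Real.exp 1 ^ 2) := by gcongr
    _ = _ := by ring

theorem coeff_link (p : ℕ) (c : ℕ → ℤ)
    (hc : ∀ q : ℂ, ‖q‖ < 1 →
      HasSum (fun n : ℕ => (c n : ℂ) * q ^ n)
        ((∏' n : ℕ, if p ∣ (n + 1) then 1 else (1 - q ^ (n + 1))) ^ 3)) (M n : ℕ) (hn : n ≤ M) :
    c n = coeff n (Gp p M ^ 3) := by
  have key := coeff_vanish (fun n => (c n : ℂ) - ((GpP p M ^ 3).coeff n : ℂ)) _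
    (fun q hq => by
      have := (hc q hq).sub (poly_hasSum (GpP p M ^ 3) q)
      simpa only [sub_mul] using this) (6 * Real.exp 1 ^ 4) M (fun q hq => by
      have h1 := prod_bound p q hq M
      have h2 : (GpP p M ^ 3).eval₂ (Int.castRingHom ℂ) q =
          (∏ n ∈ Finset.range M, if p ∣ (n + 1) then 1 else (1 - q ^ (n + 1))) ^ 3 := by
        rw [Polynomial.eval₂_pow, GpP, Polynomial.eval₂_finsetProd]
        congr 1
        refine Finset.prod_congr rfl fun i _ => ?_
        split_ifs <;> simp
      simpa only [h2] using h1) n hn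
  rw [← GpP_coe, ← Polynomial.coe_pow, Polynomial.coeff_coe]
  have := sub_eq_zero.1 key
  exact_mod_cast this

end CubicBorwein

/-- For a prime `p`, if `c : ℕ → ℤ` is the coefficient sequence of the
cube of the infinite Borwein product, i.e. `(∏_{n ≥ 1, p ∤ n} (1 - q^n))³`, then
`c n * c (n + p) ≥ 0` for all `n ≥ 0`. -/
theorem cubic_borwein_sign_pattern (p : ℕ) (hp : p.Prime) (c : ℕ → ℤ)
    (hc : ∀ q : ℂ, ‖q‖ < 1 →
      HasSum (fun n : ℕ => (c n : ℂ) * q ^ n)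
        ((∏' n : ℕ, if p ∣ (n + 1) then 1 else (1 - q ^ (n + 1))) ^ 3)) :
    ∀ n : ℕ, 0 ≤ c n * c (n + p) := by
  intro n
  obtain ⟨M₀, h⟩ := CubicBorwein.formal_case p hp n
  have h1 := h (M₀ + n + p) (by omega)
  have h2 : n + p ≤ p * (M₀ + n + p) :=
    le_trans (by omega) (Nat.le_mul_of_pos_left _ hp.pos)
  rw [CubicBorwein.coeff_link p c hc (p * (M₀ + n + p)) n (by omega),
    CubicBorwein.coeff_link p c hc (p * (M₀ + n + p)) (n + p) h2]
  exact h1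
end
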